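/- arXiv:1909.02661 — 2 statements merged into one kernel-verified Lean document; each statement's English description precedes it below -/
import Mathlib

section
/- Let X be a poset, m ≥ 0, and F: X → Ab a functor such that F(x) = 0 for all x with height(x) ≠ m. Then for all k, H_k(X; F) is isomorphic to the direct sum over all x ∈ X of height m of the reduced homology groups H̃_{k-1}(|X_{>x}|; F(x)), where F(x) is treated as a constant coefficient group. -/
open scoped DirectSum

universe u v

/-- A functor from a poset to abelian groups. -/
structure PosetFunctor (X : Type u) [PartialOrder X] : Type (max u (v + 1)) where
  obj : X → Type v
  grp : ∀ x, AddCommGroup (obj x)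
  map : ∀ {x y : X}, x ≤ y → (obj x →+ obj y)
  map_id : ∀ (x : X) (h : x ≤ x), map h = AddMonoidHom.id (obj x)
  map_comp : ∀ {x y z : X} (h1 : x ≤ y) (h2 : y ≤ z),
    map (h1.trans h2) = (map h2).comp (map h1)

attribute [instance] PosetFunctor.grp

/-- A `k`-chain in a poset: a strictly increasing `(k+1)`-tuple `x_0 < ... < x_k`. -/
def PChain (X : Type u) [PartialOrder X] (k : ℕ) : Type u :=
  {f : Fin (k + 1) → X // StrictMono f}

variable {X : Type u} [PartialOrder X]

/-- The `k`-th chain group `C_k(X;F) = ⊕_{x_0 < ... < x_k} F(x_0)`. -/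
noncomputable def PC (F : PosetFunctor.{u, v} X) (k : ℕ) : Type (max u v) :=
  DirectSum (PChain X k) (fun c => F.obj (c.1 0))

noncomputable instance (F : PosetFunctor.{u, v} X) (k : ℕ) : AddCommGroup (PC F k) := by
  unfold PC; infer_instance

/-- The `i`-th face of a chain (delete the `i`-th entry). -/
def pface {k : ℕ} (c : PChain X (k + 1)) (i : Fin (k + 2)) : PChain X k :=
  ⟨c.1 ∘ i.succAbove, c.2.comp (Fin.strictMono_succAbove i)⟩

/-- The simplicial differential `∂ = Σ (-1)^i ∂_i : C_{k+1}(X;F) → C_k(X;F)`; on the face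
deleting `x_0`, the coefficient map is `F(x_0) → F(x_1)`, on all other faces it is the
identity (uniformly expressed via the functor applied to `x_0 ≤ x_{σ(0)}`). -/
noncomputable def pboundary (F : PosetFunctor.{u, v} X) (k : ℕ) : PC F (k + 1) →+ PC F k := by
  classical
  exact DirectSum.toAddMonoid fun c =>
    ∑ i : Fin (k + 2), ((-1 : ℤ) ^ (i : ℕ)) •
      ((DirectSum.of (fun c' : PChain X k => F.obj (c'.1 0)) (pface c i)).comp
        (F.map (c.2.monotone (Fin.zero_le _))))

/-- Cycles: everything in degree `0`, the kernel of `∂` in positive degrees. -/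
noncomputable def pcycles (F : PosetFunctor.{u, v} X) : (k : ℕ) → AddSubgroup (PC F k)
  | 0 => ⊤
  | (k + 1) => (pboundary F k).ker

/-- The homology `H_k(X;F)` of a poset with coefficients in a functor. -/
noncomputable def phomology (F : PosetFunctor.{u, v} X) (k : ℕ) : Type (max u v) :=
  ↥(pcycles F k) ⧸ ((pboundary F k).range.addSubgroupOf (pcycles F k))

noncomputable instance (F : PosetFunctor.{u, v} X) (k : ℕ) :
    AddCommGroup (phomology F k) := by
  unfold phomology; infer_instance

/-- The constant functor with value an abelian group `A`. -/
def constF (X : Type u) [PartialOrder X] (A : Type v) [AddCommGroup A] :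
    PosetFunctor.{u, v} X where
  obj _ := A
  grp _ := inferInstance
  map _ := AddMonoidHom.id A
  map_id _ _ := rfl
  map_comp _ _ := rfl

/-- The augmented chain complex of (the order complex of) a poset `Y` with constant
coefficients `A`: in position `0` sits `A` (homological degree `-1`), and in position
`k+1` sits `C_k(Y; A)` (homological degree `k`). -/
noncomputable def augC (Y : Type u) [PartialOrder Y] (A : Type v) [AddCommGroup A] :
    ℕ → Type (max u v)
  | 0 => ULift.{u} A
  | (k + 1) => PC (constF Y A) k

noncomputable instance augCgrp (Y : Type u) [PartialOrder Y] (A : Type v) [AddCommGroup A] :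
    ∀ k, AddCommGroup (augC Y A k)
  | 0 => inferInstanceAs (AddCommGroup (ULift A))
  | (k + 1) => inferInstanceAs (AddCommGroup (PC (constF Y A) k))

/-- The augmentation `C_0(Y;A) → A`, summing up coefficients. -/
noncomputable def augEps (Y : Type u) [PartialOrder Y] (A : Type v) [AddCommGroup A] :
    PC (constF Y A) 0 →+ ULift.{u} A := by
  classical
  exact DirectSum.toAddMonoid fun _ =>
    (AddEquiv.ulift.symm : A ≃+ ULift A).toAddMonoidHom

/-- The differential of the augmented complex; in lowest degree it is the augmentation. -/
noncomputable def augBoundary (Y : Type u) [PartialOrder Y] (A : Type v) [AddCommGroup A] :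
    (k : ℕ) → (augC Y A (k + 1) →+ augC Y A k)
  | 0 => augEps Y A
  | (k + 1) => pboundary (constF Y A) k

noncomputable def augCycles (Y : Type u) [PartialOrder Y] (A : Type v) [AddCommGroup A] :
    (k : ℕ) → AddSubgroup (augC Y A k)
  | 0 => ⊤
  | (k + 1) => (augBoundary Y A k).ker

/-- `reducedHAug Y A k` is the reduced homology `H̃_{k-1}(|Y|; A)` of the geometric
realization (order complex) of the poset `Y` with constant coefficients `A`; position
`k` of the augmented complex corresponds to homological degree `k - 1`. -/
noncomputable def reducedHAug (Y : Type u) [PartialOrder Y] (A : Type v) [AddCommGroup A]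
    (k : ℕ) : Type (max u v) :=
  ↥(augCycles Y A k) ⧸ ((augBoundary Y A k).range.addSubgroupOf (augCycles Y A k))

noncomputable instance (Y : Type u) [PartialOrder Y] (A : Type v) [AddCommGroup A] (k : ℕ) :
    AddCommGroup (reducedHAug Y A k) := by
  unfold reducedHAug; infer_instance

theorem PosetFunctor.map_self (F : PosetFunctor.{u, v} X) {x : X} (h : x ≤ x) (a : F.obj x) :
    F.map h a = a := by
  rw [F.map_id]
  rfl

theorem PosetFunctor.map_map (F : PosetFunctor.{u, v} X) {x y z : X} (h : x ≤ y) (h' : y ≤ z)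
    (a : F.obj x) : F.map h' (F.map h a) = F.map (h.trans h') a := by
  rw [F.map_comp h h']
  rfl

/-- The first element of a chain. -/
def PChain.first {k : ℕ} (c : PChain X k) : X := c.1 0

theorem PChain.first_le_first_pface {k : ℕ} (c : PChain X (k + 1)) (i : Fin (k + 2)) :
    c.first ≤ (pface c i).first :=
  c.2.monotone (Fin.zero_le _)

open Classical in
/-- For `x` below the first element of the chain `c`, the composite of `F(x) → F(x_0)` with the
inclusion in `C_k(X;F)` of the summand of `c`. -/
noncomputable def PC.of (F : PosetFunctor.{u, v} X) {k : ℕ} (c : PChain X k) {x : X}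
    (h : x ≤ c.first) : F.obj x →+ PC F k :=
  (DirectSum.of (fun c' : PChain X k => F.obj (c'.1 0)) c).comp (F.map h)

open Classical in
/-- Extend a family of maps defined on the summands of `C_k(X;F)`. -/
noncomputable def PC.lift {F : PosetFunctor.{u, v} X} {k : ℕ} {B : Type*} [AddCommGroup B]
    (f : ∀ c : PChain X k, F.obj c.first →+ B) : PC F k →+ B :=
  DirectSum.toAddMonoid f

open Classical in
theorem PC.of_le_rfl (F : PosetFunctor.{u, v} X) {k : ℕ} (c : PChain X k) (a : F.obj c.first) :
    PC.of F c le_rfl a = DirectSum.of (fun c' : PChain X k => F.obj (c'.1 0)) c a :=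
  congrArg (DirectSum.of (fun c' : PChain X k => F.obj c'.first) c)
    (F.map_self le_rfl a)

theorem PC.lift_of {F : PosetFunctor.{u, v} X} {k : ℕ} {B : Type*} [AddCommGroup B]
    (f : ∀ c : PChain X k, F.obj c.first →+ B) (c : PChain X k) {x : X} (h : x ≤ c.first)
    (a : F.obj x) : PC.lift f (PC.of F c h a) = f c (F.map h a) := by
  classical
  exact DirectSum.toAddMonoid_of (β := fun c : PChain X k => F.obj c.first) f c (F.map h a)

theorem PC.hom_ext {F : PosetFunctor.{u, v} X} {k : ℕ} {B : Type*} [AddCommGroup B]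
    {f g : PC F k →+ B} (h : ∀ c a, f (PC.of F c le_rfl a) = g (PC.of F c le_rfl a)) : f = g := by
  classical
  refine DirectSum.addHom_ext (β := fun c : PChain X k => F.obj c.first) fun c a => ?_
  have := h c a
  rw [PC.of_le_rfl] at this
  exact this

theorem PC.of_congr (F : PosetFunctor.{u, v} X) {k : ℕ} {c c' : PChain X k} (hc : c = c')
    {x : X} (h : x ≤ c.first) (h' : x ≤ c'.first) : PC.of F c h = PC.of F c' h' := by
  subst hc
  rfl

theorem PC.of_eq_zero (F : PosetFunctor.{u, v} X) {k : ℕ} (c : PChain X k) {x : X}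
    (h : x ≤ c.first) (hc : Subsingleton (F.obj c.first)) : PC.of F c h = 0 := by
  ext a
  classical
  exact (congrArg (DirectSum.of (fun c' : PChain X k => F.obj c'.first) c)
    (Subsingleton.elim (F.map h a) 0)).trans (map_zero _)

theorem pboundary_of (F : PosetFunctor.{u, v} X) {k : ℕ} (c : PChain X (k + 1)) {x : X}
    (h : x ≤ c.first) (a : F.obj x) :
    pboundary F k (PC.of F c h a) = ∑ i : Fin (k + 2), ((-1 : ℤ) ^ (i : ℕ)) •
      PC.of F (pface c i) (h.trans (c.first_le_first_pface i)) a := by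
  classical
  refine (DirectSum.toAddMonoid_of (β := fun c : PChain X (k + 1) => F.obj c.first)
    _ c (F.map h a)).trans ?_
  refine (AddMonoidHom.finsetSum_apply _ _ _).trans (Finset.sum_congr rfl fun i _ => ?_)
  exact congrArg (fun b => ((-1 : ℤ) ^ (i : ℕ)) •
    DirectSum.of (fun c' : PChain X k => F.obj c'.first) (pface c i) b)
    (F.map_map h (c.first_le_first_pface i) a)

section augmented

variable {Y : Type u} [PartialOrder Y] {A : Type v} [AddCommGroup A]

/-- The lowest degree of the augmented complex. -/
noncomputable def augC.bot : A ≃+ augC Y A 0 := AddEquiv.ulift.symm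

/-- The inclusion of the summand of the chain `c` in the augmented complex. -/
noncomputable def augC.of {k : ℕ} (c : PChain Y k) : A →+ augC Y A (k + 1) :=
  PC.of (constF Y A) c (x := c.first) le_rfl

/-- Extend a family of maps defined on the summands of the augmented complex. -/
noncomputable def augC.lift {k : ℕ} {B : Type*} [AddCommGroup B] (f : PChain Y k → A →+ B) :
    augC Y A (k + 1) →+ B :=
  PC.lift (F := constF Y A) f

theorem augC.lift_of {k : ℕ} {B : Type*} [AddCommGroup B] (f : PChain Y k → A →+ B)
    (c : PChain Y k) (a : A) : augC.lift f (augC.of c a) = f c a :=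
  PC.lift_of (F := constF Y A) f c le_rfl a

theorem augC.hom_ext_zero {B : Type*} [AddCommGroup B] {f g : augC Y A 0 →+ B}
    (h : ∀ a, f (augC.bot a) = g (augC.bot a)) : f = g :=
  AddMonoidHom.ext fun z => h z.down

theorem augC.hom_ext_succ {k : ℕ} {B : Type*} [AddCommGroup B] {f g : augC Y A (k + 1) →+ B}
    (h : ∀ c a, f (augC.of c a) = g (augC.of c a)) : f = g :=
  PC.hom_ext (F := constF Y A) h

theorem augBoundary_zero_of (c : PChain Y 0) (a : A) :
    augBoundary Y A 0 (augC.of c a) = augC.bot a := by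
  classical
  exact DirectSum.toAddMonoid_of (β := fun _ : PChain Y 0 => A) _ c a

theorem augBoundary_succ_of {k : ℕ} (c : PChain Y (k + 1)) (a : A) :
    augBoundary Y A (k + 1) (augC.of c a) =
      ∑ i : Fin (k + 2), ((-1 : ℤ) ^ (i : ℕ)) • augC.of (pface c i) a :=
  pboundary_of (constF Y A) c (x := c.first) le_rfl a

end augmented

/-- The chain `x`. -/
def PChain.single (x : X) : PChain X 0 :=
  ⟨fun _ => x, fun i j h => absurd h (by lia)⟩

/-- Prepend `x` to a chain of elements above `x`. -/
def PChain.cons (x : X) {k : ℕ} (c : PChain {y : X // x < y} k) : PChain X (k + 1) :=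
  ⟨Fin.cons x fun i => (c.1 i).1, by
    rw [Fin.strictMono_iff_lt_succ]
    intro i
    induction i using Fin.cases with
    | zero => exact (c.1 0).2
    | succ i => exact c.2 (Fin.castSucc_lt_succ)⟩

/-- The elements of a chain after the first one. -/
def PChain.tail {k : ℕ} (c : PChain X (k + 1)) : PChain {y : X // c.first < y} k :=
  ⟨fun i => ⟨c.1 i.succ, c.2 (Fin.succ_pos i)⟩, fun _ _ h => c.2 (Fin.succ_lt_succ_iff.2 h)⟩

theorem PChain.first_single (x : X) : (PChain.single x).first = x := rfl

theorem PChain.first_cons (x : X) {k : ℕ} (c : PChain {y : X // x < y} k) :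
    (PChain.cons x c).first = x := rfl

theorem PChain.cons_tail {k : ℕ} (c : PChain X (k + 1)) : PChain.cons c.first c.tail = c :=
  Subtype.ext (Fin.cons_self_tail c.1)

theorem PChain.single_first (c : PChain X 0) : PChain.single c.first = c :=
  Subtype.ext (funext fun i => by rw [show i = 0 from Fin.fin_one_eq_zero i]; rfl)

theorem pface_cons_one (x : X) (c : PChain {y : X // x < y} 0) :
    pface (PChain.cons x c) 1 = PChain.single x :=
  Subtype.ext (funext fun i => by rw [show i = 0 from Fin.fin_one_eq_zero i]; rfl)

theorem pface_cons_succ (x : X) {k : ℕ} (c : PChain {y : X // x < y} (k + 1)) (j : Fin (k + 2)) :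
    pface (PChain.cons x c) j.succ = PChain.cons x (pface c j) := by
  refine Subtype.ext (funext fun i => ?_)
  induction i using Fin.cases with
  | zero => rfl
  | succ i =>
    change Fin.cons (α := fun _ => X) x (fun i => (c.1 i).1) (j.succ.succAbove i.succ) =
      (c.1 (j.succAbove i)).1
    rw [Fin.succ_succAbove_succ]
    rfl

theorem lt_first_pface_cons_zero (x : X) {k : ℕ} (c : PChain {y : X // x < y} k) :
    x < (pface (PChain.cons x c) 0).first :=
  (c.1 0).2

/-- Prepending `x` identifies the augmented complex of `X_{>x}` with the part of `C_*(X;F)`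
spanned by the chains starting at `x`. -/
noncomputable def consHom (F : PosetFunctor.{u, v} X) (x : X) :
    (k : ℕ) → (augC {y : X // x < y} (F.obj x) k →+ PC F k)
  | 0 => (PC.of F (PChain.single x) (PChain.first_single x).ge).comp augC.bot.symm.toAddMonoidHom
  | (_ + 1) => augC.lift fun c => PC.of F (PChain.cons x c) (PChain.first_cons x c).ge

theorem consHom_bot (F : PosetFunctor.{u, v} X) (x : X) (a : F.obj x) :
    consHom F x 0 (augC.bot a) = PC.of F (PChain.single x) (PChain.first_single x).ge a := rfl

theorem consHom_of (F : PosetFunctor.{u, v} X) (x : X) {k : ℕ}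
    (c : PChain {y : X // x < y} k) (a : F.obj x) :
    consHom F x (k + 1) (augC.of c a) = PC.of F (PChain.cons x c) (PChain.first_cons x c).ge a :=
  augC.lift_of _ c a

theorem pboundary_comp_consHom (F : PosetFunctor.{u, v} X) (x : X)
    (hx : ∀ y, x < y → Subsingleton (F.obj y)) (k : ℕ) :
    (pboundary F k).comp (consHom F x (k + 1)) =
      -(consHom F x k).comp (augBoundary {y : X // x < y} (F.obj x) k) := by
  cases k with
  | zero =>
    refine augC.hom_ext_succ fun c a => ?_
    rw [AddMonoidHom.neg_apply, AddMonoidHom.comp_apply, AddMonoidHom.comp_apply, consHom_of,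
      pboundary_of, augBoundary_zero_of, consHom_bot, Fin.sum_univ_two,
      PC.of_eq_zero F _ _ (hx _ (lt_first_pface_cons_zero x c)),
      PC.of_congr F (pface_cons_one x c) _ (PChain.first_single x).ge]
    simp
  | succ k =>
    refine augC.hom_ext_succ fun c a => ?_
    rw [AddMonoidHom.neg_apply, AddMonoidHom.comp_apply, AddMonoidHom.comp_apply, consHom_of,
      pboundary_of, augBoundary_succ_of, Fin.sum_univ_succ,
      PC.of_eq_zero F _ _ (hx _ (lt_first_pface_cons_zero x c)), AddMonoidHom.zero_apply,
      smul_zero, zero_add, map_sum, ← Finset.sum_neg_distrib]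
    refine Finset.sum_congr rfl fun j _ => ?_
    rw [map_zsmul, consHom_of, PC.of_congr F (pface_cons_succ x c j) _ (PChain.first_cons x _).ge,
      Fin.val_succ, pow_succ, mul_neg_one, neg_smul]

section decomposition

variable (p : X → Prop)

open Classical in
/-- The inclusion in `C_k(X;F)` of the sum of the augmented complexes of `X_{>x}`, for `x` with
the property `p`. -/
noncomputable def sumHom (F : PosetFunctor.{u, v} X) (k : ℕ) :
    DirectSum {x : X // p x} (fun x => augC {y : X // x.1 < y} (F.obj x.1) k) →+ PC F k :=
  DirectSum.toAddMonoid fun x => consHom F x.1 k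

open Classical in
theorem sumHom_of (F : PosetFunctor.{u, v} X) (k : ℕ) (x : {x : X // p x})
    (z : augC {y : X // x.1 < y} (F.obj x.1) k) :
    sumHom p F k (DirectSum.of _ x z) = consHom F x.1 k z :=
  DirectSum.toAddMonoid_of
    (β := fun x : {x : X // p x} => augC {y : X // x.1 < y} (F.obj x.1) k) _ x z

open Classical in
/-- Split a chain into its first element and the rest, if its first element satisfies `p`. -/
noncomputable def splitHom (F : PosetFunctor.{u, v} X) : (k : ℕ) → (PC F k →+
    DirectSum {x : X // p x} (fun x => augC {y : X // x.1 < y} (F.obj x.1) k))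
  | 0 => PC.lift fun c => if h : p c.first then
      (DirectSum.of (fun x : {x : X // p x} => augC {y : X // x.1 < y} (F.obj x.1) 0)
        ⟨c.first, h⟩).comp augC.bot.toAddMonoidHom else 0
  | (k + 1) => PC.lift fun c => if h : p c.first then
      (DirectSum.of (fun x : {x : X // p x} => augC {y : X // x.1 < y} (F.obj x.1) (k + 1))
        ⟨c.first, h⟩).comp (augC.of c.tail) else 0

open Classical in
theorem splitHom_comp_consHom (F : PosetFunctor.{u, v} X) (k : ℕ) (x : {x : X // p x}) :
    (splitHom p F k).comp (consHom F x.1 k) =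
      DirectSum.of (fun x : {x : X // p x} => augC {y : X // x.1 < y} (F.obj x.1) k) x := by
  cases k with
  | zero =>
    refine augC.hom_ext_zero fun a => ?_
    rw [AddMonoidHom.comp_apply, consHom_bot, splitHom, PC.lift_of,
      dif_pos (show p (PChain.single x.1).first from x.2)]
    exact congrArg (fun b => DirectSum.of
      (fun x : {x : X // p x} => augC {y : X // x.1 < y} (F.obj x.1) 0) x
      (augC.bot b))
      (F.map_self le_rfl a)
  | succ k =>
    refine augC.hom_ext_succ fun c a => ?_
    rw [AddMonoidHom.comp_apply, consHom_of, splitHom, PC.lift_of,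
      dif_pos (show p (PChain.cons x.1 c).first from x.2)]
    exact congrArg (fun b => DirectSum.of
      (fun x : {x : X // p x} => augC {y : X // x.1 < y} (F.obj x.1) (k + 1)) x
      (augC.of c b))
      (F.map_self le_rfl a)

theorem sumHom_bijective (F : PosetFunctor.{u, v} X)
    (hF : ∀ x, ¬ p x → Subsingleton (F.obj x)) (k : ℕ) :
    Function.Bijective (sumHom p F k) := by
  classical
  constructor
  · refine Function.LeftInverse.injective (g := splitHom p F k) fun d => ?_
    refine DFunLike.congr_fun (f := (splitHom p F k).comp (sumHom p F k))
      (g := AddMonoidHom.id _) (DirectSum.addHom_ext fun x z => ?_) d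
    rw [AddMonoidHom.comp_apply, sumHom_of, ← AddMonoidHom.comp_apply, splitHom_comp_consHom]
    rfl
  · have of_mem (c : PChain X k) (a : F.obj c.first) :
        PC.of F c le_rfl a ∈ (sumHom p F k).range := by
      by_cases h : p c.first
      · cases k with
        | zero =>
          refine ⟨DirectSum.of _ ⟨c.first, h⟩ (augC.bot a), ?_⟩
          rw [sumHom_of, consHom_bot, PC.of_congr F c.single_first _ le_rfl]
        | succ k =>
          refine ⟨DirectSum.of _ ⟨c.first, h⟩ (augC.of c.tail a), ?_⟩
          rw [sumHom_of, consHom_of, PC.of_congr F c.cons_tail _ le_rfl]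
      · rw [PC.of_eq_zero F _ _ (hF _ h)]
        exact zero_mem _
    intro z
    have key : QuotientAddGroup.mk' (sumHom p F k).range = 0 :=
      PC.hom_ext fun c a => (QuotientAddGroup.eq_zero_iff _).2 (of_mem c a)
    exact (QuotientAddGroup.eq_zero_iff z).1 (DFunLike.congr_fun key z)

theorem pboundary_sumHom (F : PosetFunctor.{u, v} X)
    (hF : ∀ x y, p x → x < y → Subsingleton (F.obj y)) (k : ℕ)
    (d : DirectSum {x : X // p x} (fun x => augC {y : X // x.1 < y} (F.obj x.1) (k + 1))) :
    pboundary F k (sumHom p F (k + 1) d) =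
      -sumHom p F k (DirectSum.map (fun x => augBoundary {y : X // x.1 < y} (F.obj x.1) k) d) := by
  classical
  refine DFunLike.congr_fun (f := (pboundary F k).comp (sumHom p F (k + 1)))
    (g := -(sumHom p F k).comp (DirectSum.map
      (fun x => augBoundary {y : X // x.1 < y} (F.obj x.1) k)))
    (DirectSum.addHom_ext fun x z => ?_) d
  rw [AddMonoidHom.neg_apply, AddMonoidHom.comp_apply, AddMonoidHom.comp_apply, DirectSum.map_of,
    sumHom_of, sumHom_of]
  exact DFunLike.congr_fun (pboundary_comp_consHom F x.1 (fun y => hF x.1 y x.2) k) z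

end decomposition

/-- Subquotients commute with direct sums. -/
theorem nonempty_subquotient_addEquiv_directSum {ι C : Type*} {D : ι → Type*} [AddCommGroup C]
    [∀ i, AddCommGroup (D i)] (e : DirectSum ι D →+ C) (he : Function.Bijective e)
    (Z R : AddSubgroup C) (Z' R' : ∀ i, AddSubgroup (D i))
    (hZ : ∀ d, e d ∈ Z ↔ ∀ i, d i ∈ Z' i) (hR : ∀ d, e d ∈ R ↔ ∀ i, d i ∈ R' i) :
    Nonempty ((Z ⧸ R.addSubgroupOf Z) ≃+
      DirectSum ι fun i => Z' i ⧸ (R' i).addSubgroupOf (Z' i)) := by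
  classical
  let s : DirectSum ι (fun i => Z' i) →+ DirectSum ι D := DirectSum.map fun i => (Z' i).subtype
  let t : DirectSum ι (fun i => Z' i) →+ Z := (e.comp s).codRestrict Z fun d =>
    (hZ _).2 fun i => by simp [s]
  have ht : Function.Surjective t := by
    rintro ⟨z, hz⟩
    obtain ⟨d, rfl⟩ := he.2 z
    have hd : d ∈ s.range := by
      rw [DirectSum.range_map]
      exact fun i _ => ⟨⟨d i, (hZ d).1 hz i⟩, rfl⟩
    obtain ⟨d', rfl⟩ := hd
    exact ⟨d', rfl⟩
  let f := (QuotientAddGroup.mk' (R.addSubgroupOf Z)).comp t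
  let g : DirectSum ι (fun i => Z' i) →+ DirectSum ι fun i => Z' i ⧸ (R' i).addSubgroupOf (Z' i) :=
    DirectSum.map fun i => QuotientAddGroup.mk' ((R' i).addSubgroupOf (Z' i))
  have hf : Function.Surjective f := (QuotientAddGroup.mk'_surjective _).comp ht
  have hg : Function.Surjective g :=
    (DirectSum.map_surjective _).2 fun i => QuotientAddGroup.mk'_surjective _
  have hker : f.ker = g.ker := by
    ext d
    have h1 : d ∈ f.ker ↔ e (s d) ∈ R := QuotientAddGroup.eq_zero_iff (t d)
    have h2 : d ∈ g.ker ↔ ∀ i, (d i : D i) ∈ R' i := by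
      rw [AddMonoidHom.mem_ker, DirectSum.ext_iff]
      refine forall_congr' fun i => ?_
      rw [DirectSum.map_apply]
      exact QuotientAddGroup.eq_zero_iff (d i)
    rw [h1, h2, hR]
    simp [s]
  exact ⟨(QuotientAddGroup.quotientKerEquivOfSurjective f hf).symm.trans
    ((QuotientAddGroup.quotientAddEquivOfEq hker).trans
      (QuotientAddGroup.quotientKerEquivOfSurjective g hg))⟩

/-- Let `X` be a poset and `F` a functor from `X` to abelian groups supported on elements
of height `m` (i.e. `F(x) = 0` when `height(x) ≠ m`).  Then for all `k`,
`H_k(X; F) ≅ ⊕_{height(x) = m} H̃_{k-1}(|X_{>x}|; F(x))`, where `F(x)` is treated as a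
constant coefficient group. -/
theorem stmt9 {X : Type u} [PartialOrder X] (m : ℕ) (F : PosetFunctor.{u, v} X)
    (hF : ∀ x : X, Order.height x ≠ (m : ℕ∞) → Subsingleton (F.obj x)) (k : ℕ) :
    Nonempty
      (phomology F k ≃+
        DirectSum {x : X // Order.height x = (m : ℕ∞)}
          (fun x => reducedHAug {y : X // x.1 < y} (F.obj x.1) k)) := by
  have hgt (x y : X) (hx : Order.height x = (m : ℕ∞)) (hxy : x < y) : Subsingleton (F.obj y) :=
    hF y fun hy => by
      have := Order.height_strictMono hxy (hx ▸ ENat.natCast_lt_top m)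
      rw [hx, hy] at this
      exact lt_irrefl _ this
  have hbij (k : ℕ) := sumHom_bijective (fun x : X => Order.height x = (m : ℕ∞)) F hF k
  have hcomm (k : ℕ) := pboundary_sumHom (fun x : X => Order.height x = (m : ℕ∞)) F hgt k
  refine nonempty_subquotient_addEquiv_directSum (sumHom _ F k) (hbij k) _ _ _ _
    (fun d => ?_) (fun d => ?_)
  · cases k with
    | zero => exact iff_of_true trivial fun _ => trivial
    | succ k =>
      change pboundary F k _ = 0 ↔ _
      rw [hcomm, neg_eq_zero, map_eq_zero_iff _ (hbij k).1, DirectSum.ext_iff]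
      refine forall_congr' fun x => ?_
      rw [DirectSum.map_apply]
      rfl
  · have : (∀ x, d x ∈ (augBoundary {y : X // x.1 < y} (F.obj x.1) k).range) ↔
        d ∈ (DirectSum.map fun x : {x : X // Order.height x = (m : ℕ∞)} =>
          augBoundary {y : X // x.1 < y} (F.obj x.1) k).range := by
      rw [DirectSum.range_map]
      exact ⟨fun h i _ => h i, fun h i => h i trivial⟩
    rw [this]
    constructor
    · rintro ⟨z, hz⟩
      obtain ⟨w, rfl⟩ := (hbij (k + 1)).2 z
      rw [hcomm, ← map_neg] at hz
      exact ⟨-w, by rw [map_neg]; exact (hbij k).1 hz⟩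
    · rintro ⟨w, rfl⟩
      exact ⟨sumHom _ F (k + 1) (-w), by rw [hcomm, map_neg, map_neg, neg_neg]⟩
end

section
/- For any prime p and n ≥ 1, the quotient of the rational Tits building T_n(Q) by the action of the principal congruence subgroup Γ_n(p) is isomorphic (as a simplicial complex) to the ±-oriented Tits building of F_p^n, whose simplices are flags of proper nonzero subspaces of F_p^n each equipped with a ±-orientation. -/
set_option synthInstance.maxHeartbeats 1000000
set_option maxHeartbeats 1000000

/-- A `k`-simplex of the Tits building `T_n(ℚ)`: a flag `0 ⊊ V_0 ⊊ ... ⊊ V_k ⊊ ℚ^n` of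
proper nonzero subspaces of `ℚ^n`. -/
def ChainQ (n k : ℕ) : Type :=
  {f : Fin (k + 1) → {V : Submodule ℚ (Fin n → ℚ) // V ≠ ⊥ ∧ V ≠ ⊤} //
    StrictMono fun t => (f t).1}

/-- The action of an integral special linear matrix on subspaces of `ℚ^n`. -/
noncomputable def slAct (n : ℕ) (A : Matrix.SpecialLinearGroup (Fin n) ℤ)
    (V : Submodule ℚ (Fin n → ℚ)) : Submodule ℚ (Fin n → ℚ) :=
  Submodule.map
    (Matrix.toLin' ((A : Matrix (Fin n) (Fin n) ℤ).map ((↑) : ℤ → ℚ))) V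

/-- Membership in the principal congruence subgroup `Γ_n(p) ⊆ SL_n(ℤ)`:
congruence to the identity matrix modulo `p`. -/
def inGamma (p n : ℕ) (A : Matrix.SpecialLinearGroup (Fin n) ℤ) : Prop :=
  ∀ i j, (((A : Matrix (Fin n) (Fin n) ℤ) i j : ℤ) : ZMod p) = if i = j then 1 else 0

/-- Two flags in `T_n(ℚ)` are identified in the quotient `T_n(ℚ)/Γ_n(p)` when some
element of `Γ_n(p)` carries one to the other. -/
def chainRel (p n k : ℕ) : ChainQ n k → ChainQ n k → Prop := fun c c' =>
  ∃ A : Matrix.SpecialLinearGroup (Fin n) ℤ,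
    inGamma p n A ∧ ∀ t, slAct n A (c.1 t).1 = (c'.1 t).1

/-- The `i`-th face of a flag in `T_n(ℚ)`. -/
def faceQ {n k : ℕ} (c : ChainQ n (k + 1)) (i : Fin (k + 2)) : ChainQ n k :=
  ⟨c.1 ∘ i.succAbove, c.2.comp (Fin.strictMono_succAbove i)⟩

/-- A vertex of the ±-oriented Tits building of `F_p^n`: a proper nonzero subspace `V`
of `F_p^n` together with a ±-orientation, i.e. a set `{ω, -ω}` where `ω` is a generator
of the top exterior power `⋀^{dim V} V`. -/
def OrVtx (p n : ℕ) : Type :=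
  {x : Σ V : Submodule (ZMod p) (Fin n → ZMod p),
        Set (⋀[ZMod p]^(Module.finrank (ZMod p) V) V) //
    (x.1 ≠ ⊥ ∧ x.1 ≠ ⊤) ∧
      ∃ ω, x.2 = {ω, -ω} ∧ Submodule.span (ZMod p) {ω} = ⊤}

/-- A `k`-simplex of the ±-oriented Tits building of `F_p^n`: a flag of ±-oriented proper
nonzero subspaces of `F_p^n`, strictly increasing on the underlying subspaces. -/
def OrChain (p n k : ℕ) : Type :=
  {f : Fin (k + 1) → OrVtx p n // StrictMono fun t => (f t).1.1}

/-- The `i`-th face of a flag in the ±-oriented Tits building. -/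
def faceO {p n k : ℕ} (c : OrChain p n (k + 1)) (i : Fin (k + 2)) : OrChain p n k :=
  ⟨c.1 ∘ i.succAbove, c.2.comp (Fin.strictMono_succAbove i)⟩

section Helpers

open Matrix

section Lifting
open SpecialLinearGroup

theorem diag2n_eq_transvections {ι F : Type*} [Fintype ι] [DecidableEq ι] [Field F]
    {i j : ι} (hij : i ≠ j) (a : F) (ha : a ≠ 0) :
    diag2n hij a ha = transvection hij a * transvection hij.symm (-a⁻¹) * transvection hij a *
      transvection hij (-1) * transvection hij.symm 1 * transvection hij (-1) := by
  apply Subtype.ext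
  change diagonal _ = (1 + single i j a) * (1 + single j i (-a⁻¹)) * (1 + single i j a) *
    (1 + single i j (-1)) * (1 + single j i 1) * (1 + single i j (-1))
  simp only [mul_add, add_mul, Matrix.one_mul, Matrix.mul_one, single_mul_single_same, hij,
    hij.symm, ne_eq, not_false_eq_true, single_mul_single_of_ne, add_zero]
  ext k l
  simp only [diagonal_apply, Matrix.add_apply, Matrix.one_apply, single_apply, mul_neg,
    neg_mul, mul_one, one_mul, mul_inv_cancel₀ ha, inv_mul_cancel₀ ha, neg_neg]
  grind

theorem map_intCast_surjective (p : ℕ) [Fact p.Prime] {m : ℕ} :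
    Function.Surjective (SpecialLinearGroup.map (n := Fin m) (Int.castRingHom (ZMod p))) := by
  intro M
  rcases subsingleton_or_nontrivial (Fin m) with hm | hm
  · refine ⟨1, ?_⟩
    obtain h | h : m = 0 ∨ m = 1 := by
      have := Fin.subsingleton_iff_le_one.1 hm
      omega
    · subst h; exact Subsingleton.elim _ _
    · subst h
      ext i j
      have := M.2
      rw [det_fin_one] at this
      rw [Subsingleton.elim i 0, Subsingleton.elim j 0]
      simpa using this.symm
  · change M ∈ Set.range _
    have ht : ∀ (i j : Fin m) (hij : i ≠ j) (a : ZMod p), transvection hij a ∈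
        Set.range (SpecialLinearGroup.map (n := Fin m) (Int.castRingHom (ZMod p))) := by
      intro i j hij a
      obtain ⟨z, rfl⟩ := ZMod.intCast_surjective a
      refine ⟨transvection hij z, ?_⟩
      ext k l
      simp [transvection_coe, Matrix.one_apply, single_apply, apply_ite (Int.cast : ℤ → ZMod p)]
    have hmul : ∀ A B, A ∈ Set.range (SpecialLinearGroup.map (n := Fin m)
        (Int.castRingHom (ZMod p))) → B ∈ Set.range (SpecialLinearGroup.map
        (Int.castRingHom (ZMod p))) → A * B ∈ Set.range (SpecialLinearGroup.map
        (Int.castRingHom (ZMod p))) := by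
      rintro _ _ ⟨A, rfl⟩ ⟨B, rfl⟩
      exact ⟨A * B, map_mul _ _ _⟩
    refine diagonal_transvection_induction' (fun M => M ∈ Set.range _) M ?_ ht hmul
    intro i j hij c hc
    rw [diag2n_eq_transvections]
    exact hmul _ _ (hmul _ _ (hmul _ _ (hmul _ _ (hmul _ _ (ht ..) (ht ..)) (ht ..)) (ht ..))
      (ht ..)) (ht ..)

open Classical in
/-- The integral sign lifting `±1` in a ring, with `1` preferred. -/
noncomputable def signLift {K : Type*} [One K] (x : K) : ℤ := if x = 1 then 1 else -1

theorem signLift_mul {K : Type*} [CommRing K] {x y : K} (hx : x = 1 ∨ x = -1)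
    (hy : y = 1 ∨ y = -1) : signLift (x * y) = signLift x * signLift y := by
  by_cases h : (-1 : K) = 1
  · have hx : x = 1 := by grind
    have hy : y = 1 := by grind
    simp [signLift, hx, hy]
  · rcases hx with rfl | rfl <;> rcases hy with rfl | rfl <;>
      simp only [signLift, one_mul, mul_one, neg_mul_neg, h, if_true, if_false]

theorem exists_lift_of_det (p : ℕ) [Fact p.Prime] {m : ℕ} (M : Matrix (Fin m) (Fin m) (ZMod p))
    (h : M.det = 1 ∨ M.det = -1) :
    ∃ H : Matrix (Fin m) (Fin m) ℤ, H.map (↑) = M ∧ H.det = signLift M.det := by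
  by_cases h1 : M.det = 1
  · obtain ⟨H, hH⟩ := map_intCast_surjective p ⟨M, h1⟩
    refine ⟨H, congrArg Subtype.val hH, ?_⟩
    simp [signLift, h1]
  · have h2 := h.resolve_left h1
    obtain ⟨m, rfl⟩ : ∃ k, m = k + 1 := Nat.exists_eq_succ_of_ne_zero <| by
      rintro rfl
      simp at h1
    set D : Fin (m + 1) → ℤ := Pi.mulSingle 0 (-1) with hD
    have hD1 : ∏ i, D i = -1 := by simp [hD]
    have hDD : diagonal (fun i => (D i : ZMod p)) * diagonal (fun i => (D i : ZMod p)) = 1 := by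
      rw [diagonal_mul_diagonal, ← diagonal_one]
      congr 1
      ext i
      by_cases hi : i = 0 <;> simp [hD, hi]
    have hd : (diagonal (fun i => (D i : ZMod p))).det = -1 := by
      rw [det_diagonal]
      simpa using congrArg (Int.cast : ℤ → ZMod p) hD1
    obtain ⟨⟨H, hHdet⟩, hH⟩ := map_intCast_surjective p ⟨M * diagonal (fun i => (D i : ZMod p)), by
      rw [det_mul, hd, h2]; simp⟩
    have hH' : (Int.castRingHom (ZMod p)).mapMatrix H = M * diagonal (fun i => (D i : ZMod p)) :=
      congrArg Subtype.val hH
    refine ⟨H * diagonal D, ?_, ?_⟩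
    · have hDm : (Int.castRingHom (ZMod p)).mapMatrix (diagonal D) =
          diagonal (fun i => (D i : ZMod p)) := by
        simp [diagonal_map]
      change (Int.castRingHom (ZMod p)).mapMatrix (H * diagonal D) = M
      rw [map_mul, hH', hDm, Matrix.mul_assoc, hDD, Matrix.mul_one]
    · simp [det_mul, hHdet, hD1, signLift, h1]

theorem det_eq_mul_of_blockTriangular {R : Type*} [CommRing R] {d e : ℕ}
    (M : Matrix (Fin (d + e)) (Fin (d + e)) R)
    (h : ∀ i j : Fin (d + e), d ≤ (i : ℕ) → (j : ℕ) < d → M i j = 0) :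
    M.det = (M.submatrix (Fin.castAdd e) (Fin.castAdd e)).det *
      (M.submatrix (Fin.natAdd d) (Fin.natAdd d)).det := by
  rw [← det_submatrix_equiv_self finSumFinEquiv M,
    ← fromBlocks_toBlocks (M.submatrix finSumFinEquiv finSumFinEquiv)]
  have : (M.submatrix finSumFinEquiv finSumFinEquiv).toBlocks₂₁ = 0 := by
    ext i j
    exact h _ _ (by simp) (by simp)
  rw [this, det_fromBlocks_zero₂₁]
  rfl

/-- A matrix modulo `p` of determinant `±1` that is block upper triangular along a flag, with all
leading minors of the flag equal to `±1`, lifts to an integral matrix of the same shape. -/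
theorem exists_blockTriangular_lift (p : ℕ) [Fact p.Prime] (k : ℕ) :
    ∀ (m : ℕ) (d : Fin k → ℕ) (_ : Monotone d) (hd : ∀ t, d t ≤ m)
      (M : Matrix (Fin m) (Fin m) (ZMod p))
      (_ : ∀ (t) (i j : Fin m), d t ≤ (i : ℕ) → (j : ℕ) < d t → M i j = 0)
      (_ : ∀ t, (M.submatrix (Fin.castLE (hd t)) (Fin.castLE (hd t))).det = 1 ∨
        (M.submatrix (Fin.castLE (hd t)) (Fin.castLE (hd t))).det = -1)
      (_ : M.det = 1 ∨ M.det = -1),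
      ∃ H : Matrix (Fin m) (Fin m) ℤ, H.map (↑) = M ∧ H.det = signLift M.det ∧
        ∀ (t) (i j : Fin m), d t ≤ (i : ℕ) → (j : ℕ) < d t → H i j = 0 := by
  induction k with
  | zero =>
    intro m d _ _ M _ _ h
    obtain ⟨H, h1, h2⟩ := exists_lift_of_det p M h
    exact ⟨H, h1, h2, fun t => t.elim0⟩
  | succ k ih =>
    intro m d hmono hd M hM hmin hdet
    obtain ⟨D, hD⟩ : ∃ D, D = d (Fin.last k) := ⟨_, rfl⟩
    obtain ⟨e, rfl⟩ : ∃ e, m = D + e := Nat.exists_eq_add_of_le (hD ▸ hd (Fin.last k))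
    have hdD : ∀ t, d t ≤ D := fun t => hD ▸ hmono (Fin.le_last t)
    set A := M.submatrix (Fin.castAdd e) (Fin.castAdd e) with hA
    set C := M.submatrix (Fin.natAdd D) (Fin.natAdd D) with hC
    have hMAC : M.det = A.det * C.det := det_eq_mul_of_blockTriangular M
      (fun i j hi hj => hM (Fin.last k) i j (hD ▸ hi) (hD ▸ hj))
    have hAdet : A.det = 1 ∨ A.det = -1 := by
      have := hmin (Fin.last k)
      revert this
      generalize hd (Fin.last k) = h
      revert h
      rw [← hD]
      exact fun _ h => h
    have hCdet : C.det = 1 ∨ C.det = -1 := by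
      rw [hMAC] at hdet
      rcases hAdet with h | h <;> rw [h] at hdet <;> rcases hdet with h' | h' <;>
        simp [neg_eq_iff_eq_neg] at h' <;> simp [h']
    obtain ⟨HA, hHA, hHAdet, hHA0⟩ := ih D (fun t => d t.castSucc)
      (fun _ _ h => hmono (Fin.castSucc_le_castSucc_iff.2 h)) (fun t => hdD _) A
      (fun t i j hi hj => hM t.castSucc _ _ hi hj) (fun t => hmin t.castSucc) hAdet
    obtain ⟨HC, hHC, hHCdet⟩ := exists_lift_of_det p C hCdet
    let B : Matrix (Fin D) (Fin e) ℤ :=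
      Matrix.of fun i j => ((M (Fin.castAdd e i) (Fin.natAdd D j)).val : ℤ)
    refine ⟨(fromBlocks HA B 0 HC).submatrix finSumFinEquiv.symm finSumFinEquiv.symm, ?_, ?_, ?_⟩
    · ext i j
      refine Fin.addCases (fun i => ?_) (fun i => ?_) i <;>
        refine Fin.addCases (fun j => ?_) (fun j => ?_) j
      · simpa [hA] using congrFun₂ hHA i j
      · simp [B, fromBlocks_apply₁₂]
      · simpa using (hM (Fin.last k) (Fin.natAdd D i) (Fin.castAdd e j) (by simp [← hD])
          (by simp [← hD])).symm
      · simpa [hC] using congrFun₂ hHC i j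
    · rw [det_submatrix_equiv_self, det_fromBlocks_zero₂₁, hHAdet, hHCdet, hMAC,
        signLift_mul hAdet hCdet]
    · intro t i j
      refine Fin.addCases (fun i => ?_) (fun i => ?_) i <;>
        refine Fin.addCases (fun j => ?_) (fun j => ?_) j
      · refine Fin.lastCases (fun h => ?_) (fun t h h' => ?_) t
        · have := i.2; simp at h; omega
        · simpa using hHA0 t i j h h'
      · intro _ h; have := hdD t; simp at h; omega
      · simp
      · intro _ h; have := hdD t; simp at h; omega

end Lifting

section ColumnFlag

variable {R : Type*} [CommRing R] {n : ℕ}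

/-- The span of the first `d` columns of a special linear matrix `g`. -/
def colFlag (g : SpecialLinearGroup (Fin n) R) (d : ℕ) : Submodule R (Fin n → R) where
  carrier := {x | ∀ j : Fin n, d ≤ j → (g⁻¹.1 *ᵥ x) j = 0}
  add_mem' {x y} hx hy j hj := by rw [mulVec_add, Pi.add_apply, hx j hj, hy j hj, add_zero]
  zero_mem' j _ := by rw [mulVec_zero, Pi.zero_apply]
  smul_mem' c x hx j hj := by rw [mulVec_smul, Pi.smul_apply, hx j hj, smul_zero]

theorem mem_colFlag {g : SpecialLinearGroup (Fin n) R} {d : ℕ} {x : Fin n → R} :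
    x ∈ colFlag g d ↔ ∀ j : Fin n, d ≤ j → (g⁻¹.1 *ᵥ x) j = 0 := Iff.rfl

theorem inv_mulVec_mulVec (g : SpecialLinearGroup (Fin n) R) (x : Fin n → R) :
    g⁻¹.1 *ᵥ (g.1 *ᵥ x) = x := by
  rw [mulVec_mulVec, ← Matrix.SpecialLinearGroup.coe_mul, inv_mul_cancel,
    Matrix.SpecialLinearGroup.coe_one, one_mulVec]

theorem mulVec_inv_mulVec (g : SpecialLinearGroup (Fin n) R) (x : Fin n → R) :
    g.1 *ᵥ (g⁻¹.1 *ᵥ x) = x := by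
  rw [mulVec_mulVec, ← Matrix.SpecialLinearGroup.coe_mul, mul_inv_cancel,
    Matrix.SpecialLinearGroup.coe_one, one_mulVec]

theorem mulVec_mem_colFlag {g : SpecialLinearGroup (Fin n) R} {d : ℕ} {x : Fin n → R} :
    g.1 *ᵥ x ∈ colFlag g d ↔ ∀ j : Fin n, d ≤ j → x j = 0 := by
  rw [mem_colFlag, inv_mulVec_mulVec]

theorem col_mem_colFlag (g : SpecialLinearGroup (Fin n) R) {d : ℕ} {j : Fin n} (hj : (j : ℕ) < d) :
    g.1.col j ∈ colFlag g d := by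
  rw [← mulVec_single_one, mulVec_mem_colFlag]
  intro i hi
  rw [Pi.single_apply, if_neg]
  rintro rfl
  omega

theorem colFlag_mono (g : SpecialLinearGroup (Fin n) R) : Monotone (colFlag g) :=
  fun _ _ h _ hx j hj => hx j (h.trans hj)

theorem colFlag_eq_span (g : SpecialLinearGroup (Fin n) R) {d : ℕ} (hd : d ≤ n) :
    colFlag g d = Submodule.span R (Set.range fun j : Fin d => g.1.col (Fin.castLE hd j)) := by
  apply le_antisymm
  · intro x hx
    rw [← mulVec_inv_mulVec g x, mulVec_eq_sum]
    apply Submodule.sum_mem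
    intro j _
    rw [op_smul_eq_smul]
    by_cases hj : (j : ℕ) < d
    · refine Submodule.smul_mem _ _ (Submodule.subset_span ?_)
      exact Set.mem_range_self (f := fun j : Fin d => g.1.col (Fin.castLE hd j)) ⟨j, hj⟩
    · rw [hx j (not_lt.1 hj)]
      simp
  · rw [Submodule.span_le, Set.range_subset_iff]
    intro j
    exact col_mem_colFlag g j.2

theorem colFlag_mul_le_iff {g g' : SpecialLinearGroup (Fin n) R} {d : ℕ} :
    colFlag g' d ≤ colFlag g d ↔
      ∀ i j : Fin n, d ≤ (i : ℕ) → (j : ℕ) < d → (g⁻¹ * g').1 i j = 0 := by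
  constructor
  · intro h i j hi hj
    have := h (col_mem_colFlag g' hj) i hi
    rwa [← mulVec_single_one, mulVec_mulVec, mulVec_single_one] at this
  · intro h x hx i hi
    rw [← mulVec_inv_mulVec g' x, mulVec_mulVec, ← Matrix.SpecialLinearGroup.coe_mul]
    rw [mulVec, dotProduct]
    apply Finset.sum_eq_zero
    intro j _
    by_cases hj : (j : ℕ) < d
    · rw [h i j hi hj, zero_mul]
    · rw [hx j (not_lt.1 hj), mul_zero]

theorem map_toLin_colFlag (A g : SpecialLinearGroup (Fin n) R) (d : ℕ) :
    (colFlag g d).map (Matrix.toLin' A.1) = colFlag (A * g) d := by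
  ext x
  rw [mem_colFlag, _root_.mul_inv_rev, Matrix.SpecialLinearGroup.coe_mul, Submodule.mem_map]
  constructor
  · rintro ⟨y, hy, rfl⟩
    rw [toLin'_apply, ← mulVec_mulVec, inv_mulVec_mulVec]
    exact hy
  · intro h
    refine ⟨A⁻¹.1 *ᵥ x, fun j hj => ?_, by rw [toLin'_apply, mulVec_inv_mulVec]⟩
    rw [mulVec_mulVec]
    exact h j hj

attribute [irreducible] colFlag

theorem inv_apply_eq_zero_of_blockTriangular {M : SpecialLinearGroup (Fin n) R} {d : ℕ}
    (h : ∀ i j : Fin n, d ≤ (i : ℕ) → (j : ℕ) < d → M.1 i j = 0) (i j : Fin n) (hi : d ≤ (i : ℕ))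
    (hj : (j : ℕ) < d) : M⁻¹.1 i j = 0 := by
  let := M.1.invertibleOfIsUnitDet (by rw [M.2]; exact isUnit_one)
  have hM : M.1.BlockTriangular fun i => decide (d ≤ (i : ℕ)) := by
    intro i j hij
    rw [Bool.lt_iff, decide_eq_false_iff_not, decide_eq_true_iff, not_le] at hij
    exact h i j hij.2 hij.1
  have hinv := blockTriangular_inv_of_blockTriangular hM (i := i) (j := j)
    (Bool.lt_iff.2 ⟨decide_eq_false hj.not_ge, decide_eq_true hi⟩)
  rwa [inv_def, M.2, Ring.inverse_one, one_smul] at hinv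

theorem colFlag_eq_iff {g g' : SpecialLinearGroup (Fin n) R} {d : ℕ} :
    colFlag g d = colFlag g' d ↔
      ∀ i j : Fin n, d ≤ (i : ℕ) → (j : ℕ) < d → (g⁻¹ * g').1 i j = 0 := by
  rw [← colFlag_mul_le_iff]
  refine ⟨fun h => h.ge, fun h => le_antisymm ?_ h⟩
  rw [colFlag_mul_le_iff] at h ⊢
  rw [show g'⁻¹ * g = (g⁻¹ * g')⁻¹ by group]
  exact inv_apply_eq_zero_of_blockTriangular h

end ColumnFlag

section ColumnFlagDomain

variable {K : Type*} [CommRing K] [IsDomain K] {n : ℕ}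

theorem linearIndependent_col (g : SpecialLinearGroup (Fin n) K) :
    LinearIndependent K g.1.col :=
  Matrix.linearIndependent_cols_of_det_ne_zero (by rw [g.2]; exact one_ne_zero)

theorem finrank_colFlag (g : SpecialLinearGroup (Fin n) K) {d : ℕ} (hd : d ≤ n) :
    Module.finrank K (colFlag g d) = d := by
  rw [colFlag_eq_span g hd, finrank_span_eq_card, Fintype.card_fin]
  exact (linearIndependent_col g).comp _ (Fin.castLE_injective hd)

theorem colFlag_ne_bot (g : SpecialLinearGroup (Fin n) K) {d : ℕ} (h0 : 0 < d) (hd : d ≤ n) :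
    colFlag g d ≠ ⊥ := by
  intro h
  have := finrank_colFlag g hd
  rw [h, finrank_bot] at this
  omega

theorem colFlag_ne_top (g : SpecialLinearGroup (Fin n) K) {d : ℕ} (hd : d < n) :
    colFlag g d ≠ ⊤ := by
  intro h
  have := finrank_colFlag g hd.le
  rw [h, finrank_top, Module.finrank_fin_fun] at this
  omega

end ColumnFlagDomain

section AdaptedBasis

theorem finrank_map_mkQ_add_finrank {R M : Type*} [CommRing R] [IsDomain R]
    [AddCommGroup M] [Module R M] {V W : Submodule R M} [Module.Finite R W] (h : V ≤ W) :
    Module.finrank R (W.map V.mkQ) + Module.finrank R V = Module.finrank R W := by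
  have e : (W ⧸ V.submoduleOf W) ≃ₗ[R] W.map V.mkQ := by
    refine (Submodule.quotEquivOfEq _ _ ?_).trans
      ((V.mkQ.domRestrict W).quotKerEquivRange.trans (LinearEquiv.ofEq _ _ ?_))
    · rw [LinearMap.ker_domRestrict, Submodule.ker_mkQ, Submodule.submoduleOf]
    · rw [LinearMap.range_domRestrict]
  rw [← e.finrank_eq, ← (Submodule.submoduleOfEquivOfLe h).finrank_eq,
    Submodule.finrank_quotient_add_finrank]

theorem exists_adapted_frame {R M : Type*} [CommRing R] [IsDomain R] [IsPrincipalIdealRing R]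
    [AddCommGroup M] [Module R M] [Module.Finite R M] (W : ℕ → Submodule R M) (hW : Monotone W)
    (h0 : W 0 = ⊥) (hsat : ∀ (i : ℕ) (r : R) (x : M), r ≠ 0 → r • x ∈ W i → x ∈ W i) (k : ℕ) :
    ∃ v : ℕ → M, ∀ i ≤ k,
      Submodule.span R (v '' Set.Iio (Module.finrank R (W i))) = W i := by
  induction k with
  | zero =>
    refine ⟨0, fun i hi => ?_⟩
    obtain rfl : i = 0 := by omega
    rw [h0, finrank_bot]
    simp
  | succ k ih =>
    obtain ⟨v, hv⟩ := ih
    have hle : W k ≤ W (k + 1) := hW k.le_succ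
    have : Module.IsTorsionFree R (M ⧸ W k) := by
      refine .of_smul_eq_zero fun r m => ?_
      obtain ⟨x, rfl⟩ := (W k).mkQ_surjective m
      intro h
      rw [← map_smul, Submodule.mkQ_apply, Submodule.Quotient.mk_eq_zero] at h
      rw [Submodule.mkQ_apply, Submodule.Quotient.mk_eq_zero]
      by_contra! hr
      exact hr.2 (hsat k r x hr.1 h)
    obtain ⟨d, hd⟩ : ∃ d, d = Module.finrank R (W k) := ⟨_, rfl⟩
    have hrank := finrank_map_mkQ_add_finrank hle
    let b := Module.finBasis R ((W (k + 1)).map (W k).mkQ)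
    have hb : ∀ j, ∃ w ∈ W (k + 1), (W k).mkQ w = b j := fun j => (b j).2
    choose w hwmem hw using hb
    let v' : ℕ → M := fun j => if j < d then v j else
      if h : j - d < Module.finrank R ((W (k + 1)).map (W k).mkQ) then w ⟨j - d, h⟩ else 0
    have hold : ∀ i ≤ k, v' '' Set.Iio (Module.finrank R (W i)) =
        v '' Set.Iio (Module.finrank R (W i)) := fun i hi => by
      refine Set.image_congr fun j hj => if_pos (lt_of_lt_of_le hj ?_)
      rw [hd]
      exact Submodule.finrank_mono (hW hi)
    have hnew : ∀ j : Fin _, v' (d + j) = w j := fun j => by simp [v']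
    refine ⟨v', fun i hi => ?_⟩
    rcases Nat.le_or_eq_of_le_succ hi with hi | hi
    · rw [hold i hi, hv i hi]
    subst hi
    have hk : Submodule.span R (v' '' Set.Iio d) = W k := by
      rw [hd, hold k le_rfl, hv k le_rfl]
    have hsub : W k ≤ Submodule.span R (v' '' Set.Iio (Module.finrank R (W (k + 1)))) := by
      rw [← hk]
      refine Submodule.span_mono (Set.image_mono (Set.Iio_subset_Iio ?_))
      omega
    have hmemw : ∀ j, w j ∈ Submodule.span R (v' '' Set.Iio (Module.finrank R (W (k + 1)))) := by
      intro j
      refine Submodule.subset_span ⟨d + j, ?_, hnew j⟩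
      rw [Set.mem_Iio]
      omega
    apply le_antisymm
    · rw [Submodule.span_le]
      rintro _ ⟨j, hj, rfl⟩
      replace hj : j < Module.finrank R (W (k + 1)) := hj
      by_cases hjd : j < d
      · exact hle (hk ▸ Submodule.subset_span ⟨j, hjd, rfl⟩)
      · obtain ⟨j, rfl⟩ := Nat.exists_eq_add_of_le (not_lt.1 hjd)
        have hj' : j < Module.finrank R ((W (k + 1)).map (W k).mkQ) := by omega
        rw [hnew ⟨j, hj'⟩]
        exact hwmem _
    · intro x (hx : x ∈ W (k + 1))
      have hx' : (W k).mkQ x ∈ (W (k + 1)).map (W k).mkQ := ⟨x, hx, rfl⟩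
      have hsum := congrArg Subtype.val (b.sum_repr ⟨_, hx'⟩)
      have hdiff : x - ∑ j, b.repr ⟨_, hx'⟩ j • w j ∈ W k := by
        rw [← Submodule.Quotient.mk_eq_zero, ← Submodule.mkQ_apply, map_sub, map_sum, sub_eq_zero]
        simp only [map_smul, hw]
        rw [AddSubmonoidClass.coe_finsetSum] at hsum
        exact hsum.symm
      rw [← sub_add_cancel x (∑ j, b.repr ⟨_, hx'⟩ j • w j)]
      exact add_mem (hsub hdiff) (Submodule.sum_mem _ fun j _ => Submodule.smul_mem _ _ (hmemw j))

end AdaptedBasis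

section FlagFrames

theorem exists_colFlag_eq {R : Type*} [CommRing R] [IsDomain R] [IsPrincipalIdealRing R] {n k : ℕ}
    (hn : 0 < n) (V : Fin k → Submodule R (Fin n → R)) (hV : Monotone V)
    (hsat : ∀ (i : Fin k) (r : R) (x : Fin n → R), r ≠ 0 → r • x ∈ V i → x ∈ V i) :
    ∃ g : SpecialLinearGroup (Fin n) R, ∀ t, V t = colFlag g (Module.finrank R (V t)) := by
  let W : ℕ → Submodule R (Fin n → R) := fun i =>
    if i = 0 then ⊥ else if h : i - 1 < k then V ⟨i - 1, h⟩ else ⊤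
  have hW : Monotone W := by
    intro i j hij
    by_cases hi : i = 0
    · simp [W, hi]
    by_cases hj : j - 1 < k
    · have hi' : i - 1 < k := by omega
      have hj0 : j ≠ 0 := by omega
      simp only [W, hi, hi', hj, hj0, if_false, dif_pos]
      exact hV (by simp only [Fin.mk_le_mk]; omega)
    · have hj0 : j ≠ 0 := by omega
      simp [W, hj, hj0]
  obtain ⟨v, hv⟩ := exists_adapted_frame W hW (if_pos rfl) (by
    intro i r x hr hx
    by_cases hi : i = 0
    · have : r • x = 0 := by simpa [W, hi] using hx
      simpa [W, hi, hr] using this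
    by_cases hi' : i - 1 < k
    · simp only [W, hi, hi', if_false, dif_pos] at hx ⊢
      exact hsat _ r x hr hx
    · simp [W, hi, hi']) (k + 1)
  have htop : Submodule.span R (v '' Set.Iio n) = ⊤ := by
    have := hv (k + 1) le_rfl
    have hWk : W (k + 1) = ⊤ := by simp [W]
    rwa [hWk, finrank_top, Module.finrank_fin_fun] at this
  let A : Matrix (Fin n) (Fin n) R := of fun i j => v j i
  have hA : IsUnit A.det := by
    rw [← isUnit_iff_isUnit_det, ← mulVec_surjective_iff_isUnit]
    change Function.Surjective A.mulVecLin
    rw [← LinearMap.range_eq_top, range_mulVecLin, ← htop]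
    congr 1
    ext x
    constructor
    · rintro ⟨j, rfl⟩
      exact ⟨j, j.2, rfl⟩
    · rintro ⟨j, hj, rfl⟩
      exact ⟨⟨j, hj⟩, rfl⟩
  obtain ⟨u, hu⟩ := hA
  let c : Fin n → Rˣ := fun j => if j = ⟨0, hn⟩ then u⁻¹ else 1
  have hdet : (A * diagonal fun j => (c j : R)).det = 1 := by
    rw [det_mul, det_diagonal, ← hu, ← Units.coe_prod, Finset.prod_ite_eq' Finset.univ]
    simp
  refine ⟨⟨_, hdet⟩, fun t => ?_⟩
  have hd : Module.finrank R (V t) ≤ n := by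
    simpa using Submodule.finrank_le (V t)
  have hVt := hv (t + 1) (by omega)
  have hWt : W (t + 1) = V t := by simp [W]
  rw [hWt] at hVt
  have hcol : ∀ j, (A * diagonal fun j => (c j : R)).col j = (c j : R) • v j := by
    intro j
    ext i
    simp [A, mul_comm]
  refine Eq.trans ?_ (colFlag_eq_span _ hd).symm
  conv_lhs => rw [← hVt]
  apply le_antisymm
  · rw [Submodule.span_le]
    rintro _ ⟨j, hj, rfl⟩
    have : v j = (↑(c ⟨j, lt_of_lt_of_le hj hd⟩)⁻¹ : R) •
        (A * diagonal fun j => (c j : R)).col (Fin.castLE hd ⟨j, hj⟩) := by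
      rw [hcol]
      exact (inv_smul_smul (c ⟨j, lt_of_lt_of_le hj hd⟩) (v j)).symm
    rw [this]
    exact Submodule.smul_mem _ _ (Submodule.subset_span ⟨⟨j, hj⟩, rfl⟩)
  · rw [Submodule.span_le]
    rintro _ ⟨j, rfl⟩
    change (A * diagonal fun j => (c j : R)).col (Fin.castLE hd j) ∈ _
    rw [hcol]
    exact Submodule.smul_mem _ _ (Submodule.subset_span ⟨j, j.2, rfl⟩)

theorem exists_diagonal_prod_eq {R : Type*} [CommRing R] {n k : ℕ} (d : Fin k → ℕ)
    (hd : Function.Injective d) (h0 : ∀ t, 0 < d t) (hdn : ∀ t, d t < n) (a : Fin k → Rˣ) :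
    ∃ c : Fin n → R, (diagonal c).det = 1 ∧
      ∀ t, ((diagonal c).submatrix (Fin.castLE (hdn t).le) (Fin.castLE (hdn t).le)).det = a t := by
  let b : ℕ → Rˣ := Function.extend d a 1
  have hb : ∀ m, (∀ t, d t ≠ m) → b m = 1 := fun m hm =>
    Function.extend_apply' _ _ _ (by rintro ⟨t, ht⟩; exact hm t ht)
  have hb0 : b 0 = 1 := hb 0 fun t => (h0 t).ne'
  have hprod : ∀ m, ∏ j : Fin m, (((b (j + 1) / b j : Rˣ)) : R) = b m := by
    intro m
    rw [← Units.coe_prod, Fin.prod_univ_eq_prod_range (fun j => b (j + 1) / b j),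
      Finset.prod_range_div, hb0, div_one]
  refine ⟨fun j => ((b (j + 1) / b j : Rˣ) : R), ?_, fun t => ?_⟩
  · rw [det_diagonal, hprod, hb n fun t => (hdn t).ne, Units.val_one]
  · rw [submatrix_diagonal _ _ (Fin.castLE_injective _), det_diagonal]
    refine (hprod (d t)).trans ?_
    rw [show b (d t) = a t from hd.extend_apply _ _ _]

end FlagFrames

section RationalFlags

theorem map_inv_mulVec {R S : Type*} [CommRing R] [CommRing S] (f : R →+* S) {n : ℕ}
    (g : SpecialLinearGroup (Fin n) R) (y : Fin n → R) :
    ((SpecialLinearGroup.map f g)⁻¹).1 *ᵥ (f ∘ y) = f ∘ (g⁻¹.1 *ᵥ y) := by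
  rw [← map_inv]
  ext i
  exact (RingHom.map_mulVec f g⁻¹.1 y i).symm

theorem exists_colFlag_rat_eq {n k : ℕ} (hn : 0 < n) (V : Fin k → Submodule ℚ (Fin n → ℚ))
    (hV : Monotone V) :
    ∃ g : SpecialLinearGroup (Fin n) ℤ, ∀ t,
      V t = colFlag (SpecialLinearGroup.map (Int.castRingHom ℚ) g) (Module.finrank ℚ (V t)) := by
  let ι : (Fin n → ℤ) →ₗ[ℤ] (Fin n → ℚ) := (Int.castAddHom ℚ).toIntLinearMap.compLeft (Fin n)
  let W : Fin k → Submodule ℤ (Fin n → ℤ) := fun t => ((V t).restrictScalars ℤ).comap ι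
  have hW : Monotone W := fun s t hst x hx => hV hst hx
  obtain ⟨g, hg⟩ := exists_colFlag_eq hn W hW (by
    intro t r x hr hx
    have hx' : (r : ℚ) • ι x ∈ V t := by
      rw [Int.cast_smul_eq_zsmul, ← map_smul]
      exact hx
    exact ((V t).smul_mem_iff (Int.cast_ne_zero.2 hr)).1 hx')
  refine ⟨g, fun t => ?_⟩
  have key : V t = colFlag (SpecialLinearGroup.map (Int.castRingHom ℚ) g)
      (Module.finrank ℤ (W t)) := by
    ext x
    obtain ⟨b, hb⟩ := IsLocalization.exist_integer_multiples_of_finite (nonZeroDivisors ℤ) x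
    choose y hy using hb
    have hb0 : ((b : ℤ) : ℚ) ≠ 0 := Int.cast_ne_zero.2 (nonZeroDivisors.ne_zero b.2)
    have hyx : ι y = ((b : ℤ) : ℚ) • x := by
      ext i
      have := hy i
      rw [Algebra.smul_def] at this
      exact this
    rw [← (V t).smul_mem_iff hb0, ← (colFlag _ _).smul_mem_iff hb0, ← hyx]
    change y ∈ W t ↔ _
    conv_lhs => rw [hg t]
    rw [mem_colFlag, mem_colFlag]
    refine forall_congr' fun j => imp_congr_right fun _ => ?_
    have := congrFun (map_inv_mulVec (Int.castRingHom ℚ) g y) j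
    rw [show ι y = Int.castRingHom ℚ ∘ y from rfl, this]
    exact Int.cast_eq_zero.symm
  have hd : Module.finrank ℤ (W t) ≤ n := by
    simpa using Submodule.finrank_le (W t)
  have := finrank_colFlag (SpecialLinearGroup.map (Int.castRingHom ℚ) g) hd
  rw [← key] at this
  rw [this]
  exact key

end RationalFlags

section TopExteriorPower

variable {K V : Type*} [CommRing K] [AddCommGroup V] [Module K V] {d : ℕ}

theorem ιMulti_eq_det_smul (b : Module.Basis (Fin d) K V) (u : Fin d → V) :
    exteriorPower.ιMulti K d u = b.det u • exteriorPower.ιMulti K d b := by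
  have : exteriorPower.ιMulti K d = (LinearMap.toSpanSingleton K _
      (exteriorPower.ιMulti K d b)).compAlternatingMap b.det := by
    refine Module.Basis.ext_alternating b fun i hi => ?_
    let σ : Equiv.Perm (Fin d) := Equiv.ofBijective i (Finite.injective_iff_bijective.1 hi)
    change exteriorPower.ιMulti K d (b ∘ σ) =
      b.det (b ∘ σ) • exteriorPower.ιMulti K d b
    rw [AlternatingMap.map_perm, AlternatingMap.map_perm, b.det_self]
    rcases Int.units_eq_one_or (Equiv.Perm.sign σ) with h | h
    · rw [h, one_smul, one_smul, one_smul]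
    · rw [h, Units.neg_smul, one_smul, Units.neg_smul, one_smul]
      exact (neg_one_smul K _).symm
  exact congrArg (fun f => f u) this

theorem span_ιMulti_basis (b : Module.Basis (Fin d) K V) :
    Submodule.span K {exteriorPower.ιMulti K d b} = ⊤ := by
  rw [eq_top_iff, ← exteriorPower.ιMulti_span, Submodule.span_le]
  rintro _ ⟨u, rfl⟩
  rw [ιMulti_eq_det_smul b u]
  exact Submodule.smul_mem _ _ (Submodule.mem_span_singleton_self _)

theorem smul_ιMulti_basis_injective (b : Module.Basis (Fin d) K V) :
    Function.Injective fun a : K => a • exteriorPower.ιMulti K d b := by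
  intro a a' h
  have := congrArg (exteriorPower.alternatingMapLinearEquiv b.det) h
  simpa only [map_smul, exteriorPower.alternatingMapLinearEquiv_apply_ιMulti, b.det_self,
    smul_eq_mul, mul_one] using this

theorem pair_smul_eq_pair_iff {M : Type*} [AddCommGroup M] [Module K M] {x : M}
    (hx : Function.Injective fun a : K => a • x) (a : K) :
    ({a • x, -(a • x)} : Set M) = {x, -x} ↔ a = 1 ∨ a = -1 := by
  constructor
  · intro h
    have : a • x ∈ ({x, -x} : Set M) := h ▸ Set.mem_insert _ _
    rcases this with h | h
    · exact .inl (hx (by simpa using h))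
    · exact .inr (hx (by simpa using h))
  · rintro (rfl | rfl)
    · rw [one_smul]
    · rw [neg_one_smul, neg_neg, Set.pair_comm]

end TopExteriorPower

section FlagOrientation

variable {K : Type*} [CommRing K] {n : ℕ}

theorem col_eq_sum (g g' : SpecialLinearGroup (Fin n) K) {d : ℕ} (hd : d ≤ n)
    (h : colFlag g d = colFlag g' d) (j : Fin d) :
    g'.1.col (Fin.castLE hd j) = ∑ i : Fin d,
      (g⁻¹ * g').1 (Fin.castLE hd i) (Fin.castLE hd j) • g.1.col (Fin.castLE hd i) := by
  have h0 := colFlag_eq_iff.1 h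
  have h1 : g'.1.col (Fin.castLE hd j) =
      ∑ i : Fin n, (g⁻¹ * g').1 i (Fin.castLE hd j) • g.1.col i := by
    have h2 : g' = g * (g⁻¹ * g') := by group
    ext l
    rw [Finset.sum_apply]
    conv_lhs => rw [h2]
    rw [col_apply, Matrix.SpecialLinearGroup.coe_mul g, mul_apply]
    exact Finset.sum_congr rfl fun i _ => mul_comm _ _
  rw [h1]
  symm
  refine Fintype.sum_of_injective (Fin.castLE hd) (Fin.castLE_injective hd) _ _ ?_ fun i => rfl
  intro i hi
  have : d ≤ (i : ℕ) := by
    by_contra! hlt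
    exact hi ⟨⟨i, hlt⟩, rfl⟩
  rw [h0 i _ this j.2, zero_smul]

variable [IsDomain K]

theorem finrank_submodule_fin_le (V : Submodule K (Fin n → K)) : Module.finrank K V ≤ n := by
  simpa using Submodule.finrank_le V

/-- The first columns of `g`, as a frame of the subspace which they span. -/
noncomputable def colFrame (V : Submodule K (Fin n → K)) (g : SpecialLinearGroup (Fin n) K)
    (h : V = colFlag g (Module.finrank K V)) (j : Fin (Module.finrank K V)) : V :=
  ⟨g.1.col (Fin.castLE (finrank_submodule_fin_le V) j), h.ge (col_mem_colFlag g j.2)⟩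

theorem linearIndependent_colFrame (V : Submodule K (Fin n → K)) (g : SpecialLinearGroup (Fin n) K)
    (h : V = colFlag g (Module.finrank K V)) : LinearIndependent K (colFrame V g h) := by
  have := (linearIndependent_col g).comp _ (Fin.castLE_injective (finrank_submodule_fin_le V))
  exact LinearIndependent.of_comp V.subtype this

theorem span_colFrame (V : Submodule K (Fin n → K)) (g : SpecialLinearGroup (Fin n) K)
    (h : V = colFlag g (Module.finrank K V)) :
    Submodule.span K (Set.range (colFrame V g h)) = ⊤ := by
  apply Submodule.map_injective_of_injective V.injective_subtype
  rw [Submodule.map_span, ← Set.range_comp, Submodule.map_top, Submodule.range_subtype]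
  exact (h.trans (colFlag_eq_span g (finrank_submodule_fin_le V))).symm

/-- The basis of a subspace given by the first columns of `g`. -/
noncomputable def colBasis (V : Submodule K (Fin n → K)) (g : SpecialLinearGroup (Fin n) K)
    (h : V = colFlag g (Module.finrank K V)) :
    Module.Basis (Fin (Module.finrank K V)) K V :=
  Module.Basis.mk (linearIndependent_colFrame V g h) (span_colFrame V g h).ge

theorem coe_colBasis (V : Submodule K (Fin n → K)) (g : SpecialLinearGroup (Fin n) K)
    (h : V = colFlag g (Module.finrank K V)) : ⇑(colBasis V g h) = colFrame V g h :=
  Module.Basis.coe_mk _ _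

/-- The leading principal minor of size `d`. -/
def leadingMinor {R : Type*} [CommRing R] {d : ℕ} (hd : d ≤ n) (M : Matrix (Fin n) (Fin n) R) : R :=
  (M.submatrix (Fin.castLE hd) (Fin.castLE hd)).det

theorem det_colFrame (V : Submodule K (Fin n → K)) (g g' : SpecialLinearGroup (Fin n) K)
    (h : V = colFlag g (Module.finrank K V)) (h' : V = colFlag g' (Module.finrank K V)) :
    (colBasis V g h).det (colFrame V g' h') =
      leadingMinor (finrank_submodule_fin_le V) (g⁻¹ * g').1 := by
  rw [Module.Basis.det_apply, leadingMinor]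
  congr 1
  ext i j
  have : colFrame V g' h' j = ∑ i, (g⁻¹ * g').1 (Fin.castLE (finrank_submodule_fin_le V) i)
      (Fin.castLE (finrank_submodule_fin_le V) j) • colBasis V g h i := by
    apply Subtype.ext
    rw [AddSubmonoidClass.coe_finsetSum, coe_colBasis]
    exact col_eq_sum g g' (finrank_submodule_fin_le V) (h.symm.trans h') j
  rw [Module.Basis.toMatrix_apply, this, Module.Basis.repr_sum_self, submatrix_apply]

/-- The orientation given by the first columns of `g`, up to sign. -/
noncomputable def colOrientation (V : Submodule K (Fin n → K)) (g : SpecialLinearGroup (Fin n) K)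
    (h : V = colFlag g (Module.finrank K V)) : Set (⋀[K]^(Module.finrank K V) V) :=
  {exteriorPower.ιMulti K _ (colFrame V g h), -exteriorPower.ιMulti K _ (colFrame V g h)}

theorem ιMulti_colFrame (V : Submodule K (Fin n → K)) (g g' : SpecialLinearGroup (Fin n) K)
    (h : V = colFlag g (Module.finrank K V)) (h' : V = colFlag g' (Module.finrank K V)) :
    exteriorPower.ιMulti K _ (colFrame V g' h') =
      leadingMinor (finrank_submodule_fin_le V) (g⁻¹ * g').1 •
        exteriorPower.ιMulti K _ (colFrame V g h) := by
  rw [← det_colFrame V g g' h h', ιMulti_eq_det_smul (colBasis V g h), coe_colBasis]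

theorem smul_ιMulti_colFrame_injective (V : Submodule K (Fin n → K))
    (g : SpecialLinearGroup (Fin n) K) (h : V = colFlag g (Module.finrank K V)) :
    Function.Injective fun a : K => a • exteriorPower.ιMulti K _ (colFrame V g h) :=
  coe_colBasis V g h ▸ smul_ιMulti_basis_injective (colBasis V g h)

theorem span_ιMulti_colFrame (V : Submodule K (Fin n → K)) (g : SpecialLinearGroup (Fin n) K)
    (h : V = colFlag g (Module.finrank K V)) :
    Submodule.span K {exteriorPower.ιMulti K _ (colFrame V g h)} = ⊤ :=
  coe_colBasis V g h ▸ span_ιMulti_basis (colBasis V g h)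

theorem colOrientation_eq_iff (V : Submodule K (Fin n → K)) (g g' : SpecialLinearGroup (Fin n) K)
    (h : V = colFlag g (Module.finrank K V)) (h' : V = colFlag g' (Module.finrank K V)) :
    colOrientation V g' h' = colOrientation V g h ↔
      leadingMinor (finrank_submodule_fin_le V) (g⁻¹ * g').1 = 1 ∨
        leadingMinor (finrank_submodule_fin_le V) (g⁻¹ * g').1 = -1 := by
  rw [colOrientation, colOrientation, ιMulti_colFrame V g g' h h']
  exact pair_smul_eq_pair_iff (K := K) (M := ⋀[K]^_ V)
    (smul_ιMulti_colFrame_injective V g h) _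

theorem exists_unit_smul_ιMulti (V : Submodule K (Fin n → K)) (g : SpecialLinearGroup (Fin n) K)
    (h : V = colFlag g (Module.finrank K V)) (ω : ⋀[K]^(Module.finrank K V) V)
    (hω : Submodule.span K {ω} = ⊤) :
    ∃ a : Kˣ, ω = (a : K) • exteriorPower.ιMulti K _ (colFrame V g h) := by
  have hmem : ω ∈ Submodule.span K {exteriorPower.ιMulti K _ (colFrame V g h)} := by
    rw [span_ιMulti_colFrame]
    exact Submodule.mem_top
  obtain ⟨a, rfl⟩ := Submodule.mem_span_singleton.1 hmem
  have hmem' : exteriorPower.ιMulti K _ (colFrame V g h) ∈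
      Submodule.span K {a • exteriorPower.ιMulti K _ (colFrame V g h)} := by
    rw [hω]
    exact Submodule.mem_top
  obtain ⟨b, hb⟩ := Submodule.mem_span_singleton.1 hmem'
  have hba : b * a = 1 := smul_ιMulti_colFrame_injective V g h
    ((mul_smul b a _).trans (hb.trans (one_smul K _).symm))
  exact ⟨(IsUnit.of_mul_eq_one_right b hba).unit, rfl⟩

theorem exists_colOrientation_eq [IsPrincipalIdealRing K] {k : ℕ} (hn : 0 < n)
    (V : Fin k → Submodule K (Fin n → K)) (hV : StrictMono V)
    (hsat : ∀ (t : Fin k) (r : K) (x : Fin n → K), r ≠ 0 → r • x ∈ V t → x ∈ V t)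
    (hrank : StrictMono fun t => Module.finrank K (V t)) (hpos : ∀ t, 0 < Module.finrank K (V t))
    (hlt : ∀ t, Module.finrank K (V t) < n) (ω : ∀ t, ⋀[K]^(Module.finrank K (V t)) (V t))
    (hω : ∀ t, Submodule.span K {ω t} = ⊤) :
    ∃ (g : SpecialLinearGroup (Fin n) K) (h : ∀ t, V t = colFlag g (Module.finrank K (V t))),
      ∀ t, {ω t, -ω t} = colOrientation (V t) g (h t) := by
  obtain ⟨g, hg⟩ := exists_colFlag_eq hn V hV.monotone hsat
  choose a ha using fun t => exists_unit_smul_ιMulti (V t) g (hg t) (ω t) (hω t)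
  obtain ⟨c, hc1, hc⟩ := exists_diagonal_prod_eq _ hrank.injective hpos hlt a
  let D : SpecialLinearGroup (Fin n) K := ⟨diagonal c, hc1⟩
  have hgD : g⁻¹ * (g * D) = D := inv_mul_cancel_left _ _
  have hflag : ∀ t, V t = colFlag (g * D) (Module.finrank K (V t)) := by
    intro t
    refine (hg t).trans (colFlag_eq_iff.2 fun i j hi hj => ?_)
    rw [hgD]
    exact diagonal_apply_ne _ (by rintro rfl; omega)
  refine ⟨g * D, hflag, fun t => ?_⟩
  have hD : leadingMinor (finrank_submodule_fin_le (V t)) D.1 = a t := hc t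
  rw [colOrientation, ιMulti_colFrame _ g (g * D) (hg t) (hflag t), hgD, hD, ← ha t]

theorem leadingMinor_map {R S : Type*} [CommRing R] [CommRing S] (f : R →+* S) {d : ℕ} (hd : d ≤ n)
    (M : Matrix (Fin n) (Fin n) R) : leadingMinor hd (M.map f) = f (leadingMinor hd M) :=
  (f.map_det _).symm

theorem leadingMinor_eq_one_or_neg_one (h : SpecialLinearGroup (Fin n) ℤ) {d : ℕ} (hd : d ≤ n)
    (h0 : ∀ i j : Fin n, d ≤ (i : ℕ) → (j : ℕ) < d → h.1 i j = 0) :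
    leadingMinor hd h.1 = 1 ∨ leadingMinor hd h.1 = -1 := by
  obtain ⟨e, rfl⟩ := Nat.exists_eq_add_of_le hd
  have := det_eq_mul_of_blockTriangular h.1 h0
  rw [h.2] at this
  exact Int.isUnit_iff.1 (IsUnit.of_mul_eq_one _ this.symm)

end FlagOrientation

section OrientedFlags

/-- A ±-orientation of a subspace of `K^n`: a generator of the top exterior power, up to sign. -/
def IsOrientation {K : Type} [CommRing K] {n : ℕ} (V : Submodule K (Fin n → K))
    (s : Set (⋀[K]^(Module.finrank K V) V)) : Prop :=
  ∃ ω, s = {ω, -ω} ∧ Submodule.span K {ω} = ⊤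

/-- A proper nonzero subspace of `K^n` with a ±-orientation. -/
def OrientedSubspace (K : Type) [CommRing K] (n : ℕ) : Type :=
  {x : Σ V : Submodule K (Fin n → K), Set (⋀[K]^(Module.finrank K V) V) //
    (x.1 ≠ ⊥ ∧ x.1 ≠ ⊤) ∧ IsOrientation x.1 x.2}

/-- A flag of `k + 1` proper nonzero subspaces of `K^n` with ±-orientations. -/
def OrientedFlag (K : Type) [CommRing K] (n k : ℕ) : Type :=
  {f : Fin (k + 1) → OrientedSubspace K n // StrictMono fun t => (f t).1.1}

/-- The face of a flag obtained by forgetting the subspace with index `i`. -/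
def OrientedFlag.face {K : Type} [CommRing K] {n k : ℕ} (c : OrientedFlag K n (k + 1))
    (i : Fin (k + 2)) : OrientedFlag K n k :=
  ⟨c.1 ∘ i.succAbove, c.2.comp (Fin.strictMono_succAbove i)⟩

theorem OrientedSubspace.exists_eq_mk {K : Type} [CommRing K] {n : ℕ}
    (x : OrientedSubspace K n) :
    ∃ (V : Submodule K (Fin n → K)) (hV : V ≠ ⊥ ∧ V ≠ ⊤)
      (s : Set (⋀[K]^(Module.finrank K V) V))
      (hs : IsOrientation V s), x = ⟨⟨V, s⟩, hV, hs⟩ :=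
  let ⟨⟨V, s⟩, hV, hs⟩ := x; ⟨V, hV, s, hs, rfl⟩

end OrientedFlags

section Vertices

variable {K : Type} [CommRing K] [IsDomain K] {n : ℕ}

/-- A proper nonzero subspace, oriented by the first columns of `g`. -/
noncomputable def orientedBy (V : Submodule K (Fin n → K)) (hV : V ≠ ⊥ ∧ V ≠ ⊤)
    (g : SpecialLinearGroup (Fin n) K)
    (h : V = colFlag g (Module.finrank K V)) : OrientedSubspace K n :=
  ⟨⟨V, colOrientation V g h⟩, hV, _, rfl, span_ιMulti_colFrame V g h⟩

/-- The span of the first `d` columns of `g`, oriented by these columns. -/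
noncomputable def colVertex (g : SpecialLinearGroup (Fin n) K) (d : ℕ) (h0 : 0 < d)
    (hd : d < n) : OrientedSubspace K n :=
  orientedBy (colFlag g d) ⟨colFlag_ne_bot g h0 hd.le, colFlag_ne_top g hd⟩ g
    (by rw [finrank_colFlag g hd.le])

theorem orientedBy_eq_colVertex (V : Submodule K (Fin n → K)) (hV : V ≠ ⊥ ∧ V ≠ ⊤)
    (g : SpecialLinearGroup (Fin n) K) (h : V = colFlag g (Module.finrank K V))
    {d : ℕ} (h0 : 0 < d) (hd : d < n) (hVd : V = colFlag g d) :
    orientedBy V hV g h = colVertex g d h0 hd := by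
  subst hVd
  rfl

theorem colVertex_fst (g : SpecialLinearGroup (Fin n) K) {d : ℕ} (h0 : 0 < d)
    (hd : d < n) : (colVertex g d h0 hd).1.1 = colFlag g d := rfl

theorem orientedBy_eq_iff (V : Submodule K (Fin n → K)) (hV : V ≠ ⊥ ∧ V ≠ ⊤)
    (g g' : SpecialLinearGroup (Fin n) K) (h : V = colFlag g (Module.finrank K V))
    (h' : V = colFlag g' (Module.finrank K V)) {d : ℕ} (hd : d ≤ n)
    (hVd : Module.finrank K V = d) :
    orientedBy V hV g' h' = orientedBy V hV g h ↔
      leadingMinor hd (g⁻¹ * g').1 = 1 ∨ leadingMinor hd (g⁻¹ * g').1 = -1 := by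
  subst hVd
  refine Iff.trans ⟨fun e => ?_, fun e => ?_⟩ (colOrientation_eq_iff V g g' h h')
  · exact sigma_mk_injective (β := fun V : Submodule K (Fin n → K) =>
      Set (⋀[K]^(Module.finrank K V) V)) (congrArg Subtype.val e)
  · exact Subtype.ext (congrArg (Sigma.mk V) e)

theorem colVertex_eq_iff_of_colFlag_eq (g g' : SpecialLinearGroup (Fin n) K) {d : ℕ}
    (h0 : 0 < d) (hd : d < n) (V : Submodule K (Fin n → K)) (h : V = colFlag g d)
    (h' : V = colFlag g' d) :
    colVertex g' d h0 hd = colVertex g d h0 hd ↔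
      leadingMinor hd.le (g⁻¹ * g').1 = 1 ∨ leadingMinor hd.le (g⁻¹ * g').1 = -1 := by
  have hV : V ≠ ⊥ ∧ V ≠ ⊤ := h ▸ ⟨colFlag_ne_bot g h0 hd.le, colFlag_ne_top g hd⟩
  have hr : Module.finrank K V = d := h ▸ finrank_colFlag g hd.le
  have e : V = colFlag g (Module.finrank K V) := hr.symm ▸ h
  have e' : V = colFlag g' (Module.finrank K V) := hr.symm ▸ h'
  have key := orientedBy_eq_iff V hV g g' e e' hd.le hr
  rwa [orientedBy_eq_colVertex V hV g e h0 hd h, orientedBy_eq_colVertex V hV g' e' h0 hd h']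
    at key

theorem colVertex_eq_iff (g g' : SpecialLinearGroup (Fin n) K) {d : ℕ} (h0 : 0 < d)
    (hd : d < n) :
    colVertex g' d h0 hd = colVertex g d h0 hd ↔
      (∀ i j : Fin n, d ≤ (i : ℕ) → (j : ℕ) < d → (g⁻¹ * g').1 i j = 0) ∧
        (leadingMinor hd.le (g⁻¹ * g').1 = 1 ∨ leadingMinor hd.le (g⁻¹ * g').1 = -1) := by
  refine Iff.trans ⟨fun h => ?_, fun h => ?_⟩
    (and_congr_left' (colFlag_eq_iff (g := g) (g' := g')))
  · have hV : colFlag g d = colFlag g' d :=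
      (colVertex_fst g h0 hd).symm.trans
        ((congrArg (fun x : OrientedSubspace K n => x.1.1) h.symm).trans (colVertex_fst g' h0 hd))
    exact ⟨hV, (colVertex_eq_iff_of_colFlag_eq g g' h0 hd _ rfl hV).1 h⟩
  · exact (colVertex_eq_iff_of_colFlag_eq g g' h0 hd _ rfl h.1).2 h.2

theorem colVertex_reduction_eq (g g' : SpecialLinearGroup (Fin n) ℤ) {d : ℕ} (h0 : 0 < d)
    (hd : d < n) (h : colFlag (SpecialLinearGroup.map (Int.castRingHom ℚ) g) d =
      colFlag (SpecialLinearGroup.map (Int.castRingHom ℚ) g') d) :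
    colVertex (SpecialLinearGroup.map (Int.castRingHom K) g') d h0 hd =
      colVertex (SpecialLinearGroup.map (Int.castRingHom K) g) d h0 hd := by
  rw [colFlag_eq_iff, ← map_inv, ← map_mul] at h
  rw [colVertex_eq_iff, ← map_inv, ← map_mul]
  have hz : ∀ i j : Fin n, d ≤ (i : ℕ) → (j : ℕ) < d → (g⁻¹ * g').1 i j = 0 :=
    fun i j hi hj => Int.cast_eq_zero.1 (h i j hi hj)
  constructor
  · intro i j hi hj
    change (((g⁻¹ * g').1 i j : ℤ) : K) = 0
    rw [hz i j hi hj, Int.cast_zero]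
  · change leadingMinor hd.le ((g⁻¹ * g').1.map (Int.castRingHom K)) = 1 ∨
      leadingMinor hd.le ((g⁻¹ * g').1.map (Int.castRingHom K)) = -1
    rw [leadingMinor_map]
    rcases leadingMinor_eq_one_or_neg_one (g⁻¹ * g') hd.le hz with h' | h' <;> rw [h'] <;> simp

theorem finrank_strictMono_of_isField (hK : IsField K) :
    StrictMono fun V : Submodule K (Fin n → K) => Module.finrank K V := by
  obtain ⟨F, rfl⟩ : ∃ F : Field K, F.toCommRing = ‹CommRing K› := ⟨hK.toField, rfl⟩
  exact fun V W h => Submodule.finrank_lt_finrank_of_lt h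

theorem finrank_lt_of_isField (hK : IsField K) {V : Submodule K (Fin n → K)} (hV : V ≠ ⊤) :
    Module.finrank K V < n := by
  have := finrank_strictMono_of_isField hK (lt_top_iff_ne_top.2 hV)
  simpa only [finrank_top, Module.finrank_fin_fun] using this

theorem finrank_pos_of_isField (hK : IsField K) {V : Submodule K (Fin n → K)} (hV : V ≠ ⊥) :
    0 < Module.finrank K V :=
  (Nat.zero_le _).trans_lt (finrank_strictMono_of_isField hK (bot_lt_iff_ne_bot.2 hV))

theorem exists_colOrientation_eq_of_isField (hK : IsField K) {k : ℕ} (hn : 0 < n)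
    (V : Fin k → Submodule K (Fin n → K)) (hV : StrictMono V)
    (hV' : ∀ t, V t ≠ ⊥ ∧ V t ≠ ⊤) (ω : ∀ t, ⋀[K]^(Module.finrank K (V t)) (V t))
    (hω : ∀ t, Submodule.span K {ω t} = ⊤) :
    ∃ (g : SpecialLinearGroup (Fin n) K)
      (h : ∀ t, V t = colFlag g (Module.finrank K (V t))),
      ∀ t, {ω t, -ω t} = colOrientation (V t) g (h t) := by
  have hprin : IsPrincipalIdealRing K := by
    let := hK.toField
    infer_instance
  refine exists_colOrientation_eq hn V hV (fun t r x hr hx => ?_)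
    ((finrank_strictMono_of_isField hK).comp hV) (fun t => finrank_pos_of_isField hK (hV' t).1)
    (fun t => finrank_lt_of_isField hK (hV' t).2) ω hω
  obtain ⟨s, hs⟩ := hK.mul_inv_cancel hr
  have := (V t).smul_mem s hx
  rwa [smul_smul, mul_comm, hs, one_smul] at this

theorem mk_eq_orientedBy (V : Submodule K (Fin n → K)) (hV : V ≠ ⊥ ∧ V ≠ ⊤)
    (s : Set (⋀[K]^(Module.finrank K V) V))
    (hs : IsOrientation V s) (g : SpecialLinearGroup (Fin n) K)
    (h : V = colFlag g (Module.finrank K V)) (e : s = colOrientation V g h) :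
    (⟨⟨V, s⟩, hV, hs⟩ : OrientedSubspace K n) = orientedBy V hV g h :=
  Subtype.ext (congrArg (Sigma.mk V) e)

theorem exists_orientedBy_eq (hK : IsField K) {k : ℕ} (hn : 0 < n) (o : OrientedFlag K n k) :
    ∃ (V : Fin (k + 1) → Submodule K (Fin n → K)) (hV : ∀ t, V t ≠ ⊥ ∧ V t ≠ ⊤)
      (g : SpecialLinearGroup (Fin n) K) (h : ∀ t, V t = colFlag g (Module.finrank K (V t))),
      StrictMono V ∧ ∀ t, o.1 t = orientedBy (V t) (hV t) g (h t) := by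
  obtain ⟨f, hf⟩ := o
  choose V hV s hs hx using fun t => (f t).exists_eq_mk
  obtain rfl : f = fun t => ⟨⟨V t, s t⟩, hV t, hs t⟩ := funext hx
  choose ω hω hspan using fun t => hs t
  obtain ⟨g, h, hg⟩ := exists_colOrientation_eq_of_isField hK hn V hf hV ω hspan
  exact ⟨V, hV, g, h, hf, fun t => mk_eq_orientedBy _ _ _ (hs t) g (h t) ((hω t).trans (hg t))⟩

end Vertices

section ChainMap

variable {p n : ℕ}

theorem finrank_pos_of_ne_bot (V : {V : Submodule ℚ (Fin n → ℚ) // V ≠ ⊥ ∧ V ≠ ⊤}) :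
    0 < Module.finrank ℚ V.1 :=
  Nat.pos_of_ne_zero fun h => V.2.1 (Submodule.finrank_eq_zero.1 h)

theorem finrank_lt_of_ne_top (V : {V : Submodule ℚ (Fin n → ℚ) // V ≠ ⊥ ∧ V ≠ ⊤}) :
    Module.finrank ℚ V.1 < n := by
  simpa using Submodule.finrank_lt V.2.2

theorem exists_integral_frame {k : ℕ} (hn : 0 < n) (c : ChainQ n k) :
    ∃ g : SpecialLinearGroup (Fin n) ℤ, ∀ t, (c.1 t).1 =
      colFlag (SpecialLinearGroup.map (Int.castRingHom ℚ) g) (Module.finrank ℚ (c.1 t).1) :=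
  exists_colFlag_rat_eq hn (fun t => (c.1 t).1) c.2.monotone

theorem inGamma_iff (p n : ℕ) (A : SpecialLinearGroup (Fin n) ℤ) :
    inGamma p n A ↔ SpecialLinearGroup.map (Int.castRingHom (ZMod p)) A = 1 := by
  refine Iff.trans ?_ (Matrix.SpecialLinearGroup.ext_iff _ _).symm
  exact forall₂_congr fun i j => Eq.congr_right one_apply.symm

/-- Block upper triangular matrices over `K` whose leading minors are `1` or `-1` lift to block
upper triangular integral matrices. -/
def LiftsBlockTriangular (K : Type) [CommRing K] (n : ℕ) : Prop :=
  ∀ (k : ℕ) (d : Fin k → ℕ) (hd : ∀ t, d t ≤ n) (M : SpecialLinearGroup (Fin n) K), Monotone d →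
    (∀ t (i j : Fin n), d t ≤ (i : ℕ) → (j : ℕ) < d t → M.1 i j = 0) →
    (∀ t, leadingMinor (hd t) M.1 = 1 ∨ leadingMinor (hd t) M.1 = -1) →
    ∃ H : SpecialLinearGroup (Fin n) ℤ, SpecialLinearGroup.map (Int.castRingHom K) H = M ∧
      ∀ t (i j : Fin n), d t ≤ (i : ℕ) → (j : ℕ) < d t → H.1 i j = 0

theorem liftsBlockTriangular_zmod (p n : ℕ) [Fact p.Prime] : LiftsBlockTriangular (ZMod p) n := by
  intro k d hd M hmono h0 h1
  obtain ⟨H, hHM, hHdet, hH0⟩ :=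
    exists_blockTriangular_lift p k n d hmono hd M.1 h0 h1 (.inl M.2)
  rw [M.2, signLift, if_pos rfl] at hHdet
  exact ⟨⟨H, hHdet⟩, Subtype.ext hHM, hH0⟩

variable {K : Type} [CommRing K] [IsDomain K]

/-- The ±-oriented subspace of `F_p^n` obtained by reducing an integral basis of the lattice of
integral points of `V`. -/
noncomputable def vertexMap (K : Type) [CommRing K] [IsDomain K] (hn : 0 < n)
    (V : {V : Submodule ℚ (Fin n → ℚ) // V ≠ ⊥ ∧ V ≠ ⊤}) : OrientedSubspace K n :=
  colVertex (SpecialLinearGroup.map (Int.castRingHom K)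
      (exists_integral_frame (k := 0) hn ⟨fun _ => V, Subsingleton.strictMono (α := Fin 1) _⟩).choose)
    (Module.finrank ℚ V.1) (finrank_pos_of_ne_bot V) (finrank_lt_of_ne_top V)

theorem vertexMap_eq (hn : 0 < n) (V : {V : Submodule ℚ (Fin n → ℚ) // V ≠ ⊥ ∧ V ≠ ⊤})
    (g : SpecialLinearGroup (Fin n) ℤ) {d : ℕ} (h0 : 0 < d) (hd : d < n)
    (h : V.1 = colFlag (SpecialLinearGroup.map (Int.castRingHom ℚ) g) d) :
    vertexMap K hn V =
      colVertex (SpecialLinearGroup.map (Int.castRingHom K) g) d h0 hd := by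
  obtain rfl : Module.finrank ℚ V.1 = d := by rw [h, finrank_colFlag _ hd.le]
  refine colVertex_reduction_eq _ _ h0 hd (h.symm.trans ?_)
  exact (exists_integral_frame (k := 0) hn
    ⟨fun _ => V, Subsingleton.strictMono (α := Fin 1) _⟩).choose_spec 0

/-- The map induced by `vertexMap` on flags. -/
noncomputable def chainMap (K : Type) [CommRing K] [IsDomain K] {k : ℕ} (hn : 0 < n) (c : ChainQ n k) :
    OrientedFlag K n k :=
  ⟨fun t => vertexMap K hn (c.1 t), by
    obtain ⟨g, hg⟩ := exists_integral_frame hn c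
    intro s t hst
    have hrank := Submodule.finrank_lt_finrank_of_lt (c.2 hst)
    have hd := fun t => finrank_lt_of_ne_top (c.1 t)
    have hv := fun t => vertexMap_eq (K := K) hn (c.1 t) g (finrank_pos_of_ne_bot _) (hd t) (hg t)
    simp only [hv]
    refine lt_of_le_of_ne (colFlag_mono _ hrank.le) fun h => hrank.ne ?_
    rw [← finrank_colFlag (SpecialLinearGroup.map (Int.castRingHom K) g) (hd s).le,
      ← finrank_colFlag (SpecialLinearGroup.map (Int.castRingHom K) g) (hd t).le]
    exact congrArg (fun V : Submodule K (Fin n → K) => Module.finrank K V) h⟩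

theorem slAct_colFlag (A g : SpecialLinearGroup (Fin n) ℤ) (d : ℕ) :
    slAct n A (colFlag (SpecialLinearGroup.map (Int.castRingHom ℚ) g) d) =
      colFlag (SpecialLinearGroup.map (Int.castRingHom ℚ) (A * g)) d := by
  rw [map_mul, ← map_toLin_colFlag]
  rfl

theorem chainMap_eq_of_chainRel
    (hG : ∀ A, inGamma p n A ↔ SpecialLinearGroup.map (Int.castRingHom K) A = 1)
    {k : ℕ} (hn : 0 < n) {c c' : ChainQ n k}
    (h : chainRel p n k c c') : chainMap K hn c = chainMap K hn c' := by
  obtain ⟨A, hA, hc⟩ := h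
  obtain ⟨g, hg⟩ := exists_integral_frame hn c
  refine Subtype.ext (funext fun t => ?_)
  change vertexMap K hn (c.1 t) = vertexMap K hn (c'.1 t)
  have h0 := finrank_pos_of_ne_bot (c.1 t)
  have hd := finrank_lt_of_ne_top (c.1 t)
  have hct : (c'.1 t).1 = colFlag (SpecialLinearGroup.map (Int.castRingHom ℚ) (A * g))
      (Module.finrank ℚ (c.1 t).1) := by
    rw [← slAct_colFlag, ← hg t, hc t]
  rw [vertexMap_eq hn _ g h0 hd (hg t), vertexMap_eq hn _ (A * g) h0 hd hct, map_mul,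
    (hG A).1 hA, one_mul]

theorem chainRel_of_chainMap_eq
    (hG : ∀ A, inGamma p n A ↔ SpecialLinearGroup.map (Int.castRingHom K) A = 1)
    (hL : LiftsBlockTriangular K n) {k : ℕ} (hn : 0 < n) {c c' : ChainQ n k}
    (h : chainMap K hn c = chainMap K hn c') : chainRel p n k c c' := by
  obtain ⟨g, hg⟩ := exists_integral_frame hn c
  obtain ⟨g', hg'⟩ := exists_integral_frame hn c'
  have h0 := fun t => finrank_pos_of_ne_bot (c.1 t)
  have hd := fun t => finrank_lt_of_ne_top (c.1 t)
  have hd' := fun t => finrank_lt_of_ne_top (c'.1 t)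
  have hv : ∀ t, vertexMap K hn (c'.1 t) = vertexMap K hn (c.1 t) := fun t =>
    (congrArg (fun x : OrientedFlag K n k => x.1 t) h).symm
  have hrank : ∀ t, Module.finrank ℚ (c'.1 t).1 = Module.finrank ℚ (c.1 t).1 := by
    intro t
    have := hv t
    rw [vertexMap_eq hn _ g (h0 t) (hd t) (hg t),
      vertexMap_eq hn _ g' (finrank_pos_of_ne_bot _) (hd' t) (hg' t)] at this
    rw [← finrank_colFlag (SpecialLinearGroup.map (Int.castRingHom K) g) (hd t).le,
      ← finrank_colFlag (SpecialLinearGroup.map (Int.castRingHom K) g') (hd' t).le]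
    exact congrArg (fun x : OrientedSubspace K n => Module.finrank K x.1.1) this
  simp only [hrank] at hg'
  have hiff := fun t => (colVertex_eq_iff _ _ (h0 t) (hd t)).1
    ((vertexMap_eq hn _ g' (h0 t) (hd t) (hg' t)).symm.trans
      ((hv t).trans (vertexMap_eq hn _ g (h0 t) (hd t) (hg t))))
  simp only [← map_inv, ← map_mul] at hiff
  obtain ⟨h', hred, hH0⟩ := hL (k + 1) (fun t => Module.finrank ℚ (c.1 t).1)
    (fun t => (hd t).le) (SpecialLinearGroup.map (Int.castRingHom K) (g⁻¹ * g'))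
    (fun s t hst => Submodule.finrank_mono (c.2.monotone hst))
    (fun t => (hiff t).1) (fun t => (hiff t).2)
  refine ⟨g' * h'⁻¹ * g⁻¹, ?_, fun t => ?_⟩
  · rw [hG, map_mul, map_mul, map_inv, hred, ← map_inv, ← map_mul, ← map_mul, ← map_one
      (SpecialLinearGroup.map (Int.castRingHom K))]
    congr 1
    group
  · rw [hg t, slAct_colFlag, hg' t, inv_mul_cancel_right, colFlag_eq_iff, ← map_inv,
      ← map_mul]
    intro i j hi hj
    have : (g' * h'⁻¹)⁻¹ * g' = h' := by group
    rw [this]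
    change ((h'.1 i j : ℤ) : ℚ) = 0
    rw [hH0 t i j hi hj, Int.cast_zero]

theorem chainMap_surjective (hK : IsField K) (hL : LiftsBlockTriangular K n) {k : ℕ}
    (hn : 0 < n) : Function.Surjective (chainMap K hn : ChainQ n k → OrientedFlag K n k) := by
  intro o
  obtain ⟨V, hV, g, hflag, hmono, ho⟩ := exists_orientedBy_eq hK hn o
  obtain ⟨g, rfl, -⟩ := hL 0 nofun nofun g (Subsingleton.monotone _) nofun nofun
  have hd : ∀ t, Module.finrank K (V t) < n := fun t => finrank_lt_of_isField hK (hV t).2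
  have h0 : ∀ t, 0 < Module.finrank K (V t) := fun t => finrank_pos_of_isField hK (hV t).1
  refine ⟨⟨fun t => ⟨colFlag (SpecialLinearGroup.map (Int.castRingHom ℚ) g)
    (Module.finrank K (V t)), colFlag_ne_bot _ (h0 t) (hd t).le, colFlag_ne_top _ (hd t)⟩, ?_⟩, ?_⟩
  · intro s t hst
    have hrank : Module.finrank K (V s) < Module.finrank K (V t) :=
      finrank_strictMono_of_isField hK (hmono hst)
    refine lt_of_le_of_ne (colFlag_mono _ hrank.le) fun h => hrank.ne ?_
    rw [← finrank_colFlag (SpecialLinearGroup.map (Int.castRingHom ℚ) g) (hd s).le,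
      ← finrank_colFlag (SpecialLinearGroup.map (Int.castRingHom ℚ) g) (hd t).le]
    exact congrArg (fun V : Submodule ℚ (Fin n → ℚ) => Module.finrank ℚ V) h
  · refine Subtype.ext (funext fun t => ?_)
    refine (vertexMap_eq hn _ g (h0 t) (hd t) rfl).trans ?_
    exact (orientedBy_eq_colVertex (V t) (hV t) _ (hflag t) (h0 t) (hd t) (hflag t)).symm.trans
      (ho t).symm

theorem exists_orbit_equiv (hK : IsField K) (hL : LiftsBlockTriangular K n)
    (hG : ∀ A, inGamma p n A ↔ SpecialLinearGroup.map (Int.castRingHom K) A = 1) (hn : 0 < n) :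
    ∃ e : ∀ k, Quot (chainRel p n k) ≃ OrientedFlag K n k,
      ∀ (k : ℕ) (c : ChainQ n (k + 1)) (i : Fin (k + 2)),
        e k (Quot.mk _ (faceQ c i)) = (e (k + 1) (Quot.mk _ c)).face i := by
  refine ⟨fun k => Equiv.ofBijective (Quot.lift (chainMap K hn)
    fun _ _ h => chainMap_eq_of_chainRel hG hn h) ⟨?_, ?_⟩, fun k c i => rfl⟩
  · rintro ⟨c⟩ ⟨c'⟩ h
    exact Quot.sound (chainRel_of_chainMap_eq hG hL hn h)
  · intro o
    obtain ⟨c, rfl⟩ := chainMap_surjective hK hL hn o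
    exact ⟨Quot.mk _ c, rfl⟩

end ChainMap

end Helpers

/-- For any prime `p` and `n ≥ 1`, the quotient `T_n(ℚ)/Γ_n(p)` of the rational Tits
building by the principal congruence subgroup is isomorphic, as a simplicial complex, to
the ±-oriented Tits building of `F_p^n`: there are compatible bijections between the
`Γ_n(p)`-orbits of `k`-simplices of `T_n(ℚ)` and the `k`-simplices of the ±-oriented
building, commuting with all face maps. -/
theorem stmt13 (p n : ℕ) (hp : p.Prime) (hn : 1 ≤ n) :
    ∃ e : ∀ k, Quot (chainRel p n k) ≃ OrChain p n k,
      ∀ (k : ℕ) (c : ChainQ n (k + 1)) (i : Fin (k + 2)),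
        e k (Quot.mk _ (faceQ c i)) = faceO (e (k + 1) (Quot.mk _ c)) i := by
  have := Fact.mk hp
  exact exists_orbit_equiv (Field.toIsField (ZMod p)) (liftsBlockTriangular_zmod p n)
    (inGamma_iff p n) hn
end
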